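/- arXiv:2604.17855 — 7 statements merged into one kernel-verified Lean document; each statement's English description precedes it below -/
import Mathlib

section
/- Let U ⊆ ℝⁿ be open and let ∇ be a torsion-free affine connection on U with curvature R_{ab}^c_d, and assume ∇_a R_{bc}^d_e = 0 on U. Then for every point x₀ ∈ U, every covector v ∈ (ℝⁿ)*, and every antisymmetric bilinear form m ∈ K_{x₀}, there exist an open neighborhood V ⊆ U of x₀ and a smooth 1-form σ_b on V such that ∇_a σ_b + ∇_b σ_a = 0 on V, σ(x₀) = v, and ∇_a σ_b (x₀) = m_{ab}. In particular, at every point of an affine locally symmetric space the local Killing 1-forms attain every prescribed value and every prescribed covariant derivative in K. -/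
open scoped BigOperators

noncomputable section

/-- Partial derivative in coordinate direction `a`. -/
def pd {n : ℕ} (a : Fin n) (f : (Fin n → ℝ) → ℝ) (x : Fin n → ℝ) : ℝ :=
  fderiv ℝ f x (Pi.single a 1)

/-- Curvature `R_{ab}ᶜ_d` of the affine connection with Christoffel symbols `Γ`. -/
def curv {n : ℕ} (Γ : Fin n → Fin n → Fin n → (Fin n → ℝ) → ℝ)
    (a b c d : Fin n) (x : Fin n → ℝ) : ℝ :=
  pd a (Γ b d c) x - pd b (Γ a d c) x +
    ∑ e, (Γ b d e x * Γ a e c x - Γ a d e x * Γ b e c x)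

/-- Covariant derivative `∇_a R_{bc}ᵈ_e` of the curvature. -/
def covR {n : ℕ} (Γ : Fin n → Fin n → Fin n → (Fin n → ℝ) → ℝ)
    (a b c d e : Fin n) (x : Fin n → ℝ) : ℝ :=
  pd a (curv Γ b c d e) x - ∑ f, Γ a b f x * curv Γ f c d e x
    - ∑ f, Γ a c f x * curv Γ b f d e x + ∑ f, Γ a f d x * curv Γ b c f e x
    - ∑ f, Γ a e f x * curv Γ b c d f x

/-- Membership of an antisymmetric bilinear form `m` in the space `K_x`. -/
def Kmem {n : ℕ} (Γ : Fin n → Fin n → Fin n → (Fin n → ℝ) → ℝ)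
    (x : Fin n → ℝ) (m : Fin n → Fin n → ℝ) : Prop :=
  (∀ b c, m b c = - m c b) ∧
  ∀ a b c d, ∑ e, (curv Γ a b e c x * m d e - curv Γ a b e d x * m c e
    + curv Γ c d e a x * m b e - curv Γ c d e b x * m a e) = 0

/-- Covariant derivative `∇_a σ_b` of a 1-form. -/
def cov1 {n : ℕ} (Γ : Fin n → Fin n → Fin n → (Fin n → ℝ) → ℝ)
    (a : Fin n) (σ : Fin n → (Fin n → ℝ) → ℝ) (b : Fin n) (x : Fin n → ℝ) : ℝ :=
  pd a (σ b) x - ∑ e, Γ a b e x * σ e x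

open scoped Topology ContDiff
open Set Metric

/-- Picard–Lindelöf on `[0, 1]`, recording that the solution stays in the closed ball. -/
theorem exists_hasDerivWithinAt_mem_closedBall {E : Type*} [NormedAddCommGroup E]
    [NormedSpace ℝ E] [CompleteSpace E] {f : ℝ → E → E} {e₀ : E} {a L K : NNReal}
    (hLip : ∀ t ∈ Icc (0 : ℝ) 1, LipschitzOnWith K (f t) (closedBall e₀ a))
    (hcont : ∀ e ∈ closedBall e₀ a, ContinuousOn (f · e) (Icc 0 1))
    (hnorm : ∀ t ∈ Icc (0 : ℝ) 1, ∀ e ∈ closedBall e₀ a, ‖f t e‖ ≤ L) (hLa : L ≤ a) :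
    ∃ α : ℝ → E, α 0 = e₀ ∧ (∀ t, α t ∈ closedBall e₀ a) ∧
      ∀ t ∈ Icc (0 : ℝ) 1, HasDerivWithinAt α (f t (α t)) (Icc 0 1) t := by
  have hf : IsPicardLindelof f (⟨0, by simp⟩ : Icc (0 : ℝ) 1) e₀ a 0 L K :=
    ⟨hLip, hcont, hnorm, by simpa using hLa⟩
  obtain ⟨α, hα⟩ := ODE.FunSpace.exists_isFixedPt_next hf (mem_closedBall_self le_rfl)
  refine ⟨α.compProj, ?_, fun t ↦ α.compProj_mem_closedBall hf.mul_max_le, fun t ht ↦ ?_⟩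
  · have := ODE.FunSpace.compProj_val (α := α) (t := ⟨0, by simp⟩)
    rw [← hα, ODE.FunSpace.next_apply₀, hα] at this
    exact this
  apply ODE.hasDerivWithinAt_picard_Icc (by simp : (0 : ℝ) ∈ Icc 0 1) hf.continuousOn_uncurry
    α.continuous_compProj.continuousOn (fun _ ht' ↦ α.compProj_mem_closedBall hf.mul_max_le)
    e₀ ht |>.congr_of_mem _ ht
  intro t' ht'
  nth_rw 1 [← hα]
  rw [ODE.FunSpace.compProj_of_mem ht', ODE.FunSpace.next_apply]

/-- Uniform first and second order Taylor bounds for a `C²` map near a point. -/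
theorem ContDiffAt.exists_ball_taylor_bounds {P Q : Type*} [NormedAddCommGroup P]
    [NormedSpace ℝ P] [NormedAddCommGroup Q] [NormedSpace ℝ Q] {F : P → Q} {p₀ : P}
    (hF : ContDiffAt ℝ 2 F p₀) :
    ∃ r > 0, ∃ M : ℝ, 1 ≤ M ∧ ∀ p ∈ ball p₀ r, DifferentiableAt ℝ F p ∧ ‖F p‖ ≤ M ∧
      ‖fderiv ℝ F p‖ ≤ M ∧ ∀ q ∈ ball p₀ r, ‖F q - F p‖ ≤ M * ‖q - p‖ ∧
        ‖F q - F p - fderiv ℝ F p (q - p)‖ ≤ M * ‖q - p‖ ^ 2 := by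
  have hF' : ContDiffAt ℝ 1 (fderiv ℝ F) p₀ := hF.fderiv_right (by norm_num)
  obtain ⟨K, s, hs, hK⟩ := hF'.exists_lipschitzOnWith
  have h1 : ∀ᶠ p in 𝓝 p₀, ‖F p‖ < ‖F p₀‖ + 1 :=
    hF.continuousAt.norm.eventually_lt_const (by linarith)
  have h2 : ∀ᶠ p in 𝓝 p₀, ‖fderiv ℝ F p‖ < ‖fderiv ℝ F p₀‖ + 1 :=
    hF'.continuousAt.norm.eventually_lt_const (by linarith)
  have h3 : ∀ᶠ p in 𝓝 p₀, DifferentiableAt ℝ F p :=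
    (hF.eventually (by simp)).mono fun p hp ↦ hp.differentiableAt (by simp)
  obtain ⟨r, hr, hball⟩ := Metric.eventually_nhds_iff_ball.1
    (h1.and (h2.and (h3.and (Filter.eventually_mem_set.2 hs))))
  set M : ℝ := ‖F p₀‖ + ‖fderiv ℝ F p₀‖ + K + 1
  have hFn := norm_nonneg (F p₀)
  have hF'n := norm_nonneg (fderiv ℝ F p₀)
  have hKn := K.coe_nonneg
  refine ⟨r, hr, M, by simp only [M]; linarith, fun p hp ↦ ?_⟩
  obtain ⟨a1, a2, a3, a4⟩ := hball p hp
  refine ⟨a3, by simp only [M]; linarith, by simp only [M]; linarith, fun q hq ↦ ⟨?_, ?_⟩⟩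
  · refine (convex_ball p₀ r).norm_image_sub_le_of_norm_fderiv_le (𝕜 := ℝ)
      (fun z hz ↦ (hball z hz).2.2.1) (fun z hz ↦ ?_) hp hq
    have := (hball z hz).2.1
    simp only [M]; linarith
  · have hseg : segment ℝ p q ⊆ ball p₀ r := (convex_ball p₀ r).segment_subset hp hq
    have key := (convex_segment p q).norm_image_sub_le_of_norm_hasFDerivWithin_le (𝕜 := ℝ)
      (f := fun z ↦ F z - fderiv ℝ F p z) (f' := fun z ↦ fderiv ℝ F z - fderiv ℝ F p)
      (C := M * ‖q - p‖)
      (fun z hz ↦ ((hball z (hseg hz)).2.2.1.hasFDerivAt.sub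
        (fderiv ℝ F p).hasFDerivAt).hasFDerivWithinAt) ?_
      (left_mem_segment ℝ p q) (right_mem_segment ℝ p q)
    · calc _ = ‖F q - fderiv ℝ F p q - (F p - fderiv ℝ F p p)‖ := by
            rw [map_sub]; congr 1; abel
        _ ≤ _ := key
        _ = _ := by ring
    · intro z hz
      have hz' : ‖z - p‖ ≤ ‖q - p‖ := by
        obtain ⟨t, ht, rfl⟩ := (segment_eq_image' ℝ p q) ▸ hz
        rw [add_sub_cancel_left, norm_smul, Real.norm_of_nonneg ht.1]
        exact mul_le_of_le_one_left (norm_nonneg _) ht.2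
      have := hK.dist_le_mul z (hball z (hseg hz)).2.2.2 p a4
      rw [dist_eq_norm, dist_eq_norm] at this
      refine this.trans (mul_le_mul ?_ hz' (norm_nonneg _) ?_) <;> simp only [M] <;> linarith

/-- **Frobenius theorem** for the overdetermined system `dψ = F(x, ψ)`, where integrability is
only required on the zero set of a constraint `C` that is propagated by the system. -/
theorem exists_local_solution_of_integrable_on_constraint {X E G : Type*}
    [NormedAddCommGroup X] [NormedSpace ℝ X] [NormedAddCommGroup E] [NormedSpace ℝ E]
    [CompleteSpace E] [NormedAddCommGroup G] [NormedSpace ℝ G]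
    {F : X × E → X →L[ℝ] E} {C : X × E → G} {x₀ : X} {e₀ : E}
    (hF : ContDiffAt ℝ 2 F (x₀, e₀)) (hC₀ : C (x₀, e₀) = 0) {M₀ : ℝ}
    (hC : ∀ᶠ p in 𝓝 (x₀, e₀), DifferentiableAt ℝ C p ∧
      ∀ h, ‖fderiv ℝ C p (h, F p h)‖ ≤ M₀ * ‖h‖ * ‖C p‖)
    (hflat : ∀ᶠ p in 𝓝 (x₀, e₀), C p = 0 →
      ∀ h k, fderiv ℝ F p (h, F p h) k = fderiv ℝ F p (k, F p k) h)
    {N : Set (X × E)} (hN : N ∈ 𝓝 (x₀, e₀)) :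
    ∃ V : Set X, IsOpen V ∧ x₀ ∈ V ∧ ∃ ψ : X → E, ψ x₀ = e₀ ∧
      ∀ x ∈ V, (x, ψ x) ∈ N ∧ C (x, ψ x) = 0 ∧ HasFDerivAt ψ (F (x, ψ x)) x := by
  obtain ⟨r₁, hr₁, M, hM, hB⟩ := hF.exists_ball_taylor_bounds
  obtain ⟨r₂, hr₂, hB₂⟩ := Metric.eventually_nhds_iff_ball.1
    (hC.and (hflat.and (Filter.eventually_mem_set.2 hN)))
  set r := min r₁ r₂
  have hr : 0 < r := lt_min hr₁ hr₂
  have hb₁ : ∀ p ∈ ball (x₀, e₀) r, p ∈ ball (x₀, e₀) r₁ :=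
    fun p hp ↦ ball_subset_ball (min_le_left _ _) hp
  have hb₂ : ∀ p ∈ ball (x₀, e₀) r, p ∈ ball (x₀, e₀) r₂ :=
    fun p hp ↦ ball_subset_ball (min_le_right _ _) hp
  have hM0 : 0 < M := by linarith
  set a := r / 4
  have ha : 0 < a := by positivity
  set δ := a / M
  have hδ : 0 < δ := by positivity
  have hMδ : M * δ = a := by simp only [δ]; field_simp
  have hδa : δ ≤ a := by nlinarith
  have mem : ∀ x e, ‖x - x₀‖ < r → ‖e - e₀‖ < r → (x, e) ∈ ball (x₀, e₀) r := by
    intro x e hx he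
    rw [mem_ball, dist_eq_norm, Prod.mk_sub_mk, Prod.norm_mk]
    exact max_lt hx he
  have hγ : ∀ y ∈ ball x₀ δ, ∀ t ∈ Icc (0 : ℝ) 1, ‖x₀ + t • (y - x₀) - x₀‖ < δ := by
    intro y hy t ht
    rw [add_sub_cancel_left, norm_smul, Real.norm_of_nonneg ht.1]
    rw [mem_ball, dist_eq_norm] at hy
    exact (mul_le_of_le_one_left (norm_nonneg _) ht.2).trans_lt hy
  have hLip : ∀ y ∈ ball x₀ δ, ∀ t ∈ Icc (0 : ℝ) 1,
      LipschitzOnWith ⟨a, ha.le⟩ (fun e ↦ F (x₀ + t • (y - x₀), e) (y - x₀)) (ball e₀ r) := by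
    intro y hy t ht
    refine LipschitzOnWith.of_dist_le_mul fun e he e' he' ↦ ?_
    have hx : ‖x₀ + t • (y - x₀) - x₀‖ < r :=
      (hγ y hy t ht).trans_le (by simp only [a] at *; linarith)
    rw [mem_ball, dist_eq_norm] at he he' hy
    have := ((hB _ (hb₁ _ (mem _ e' hx he'))).2.2.2 _ (hb₁ _ (mem _ e hx he))).1
    rw [Prod.mk_sub_mk, sub_self, Prod.norm_mk, norm_zero, max_eq_right (norm_nonneg _)] at this
    rw [dist_eq_norm, dist_eq_norm, ← sub_apply]
    refine (ContinuousLinearMap.le_opNorm _ _).trans ?_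
    calc _ ≤ (M * ‖e - e'‖) * δ := by gcongr
      _ = (M * δ) * ‖e - e'‖ := by ring
      _ = _ := by rw [hMδ]; rfl
  have hsol : ∀ y ∈ ball x₀ δ, ∃ α : ℝ → E, α 0 = e₀ ∧ (∀ t, α t ∈ closedBall e₀ a) ∧
      ∀ t ∈ Icc (0 : ℝ) 1,
        HasDerivWithinAt α (F (x₀ + t • (y - x₀), α t) (y - x₀)) (Icc 0 1) t := by
    intro y hy
    have hcl : closedBall e₀ a ⊆ ball e₀ r := closedBall_subset_ball (by simp only [a]; linarith)
    refine exists_hasDerivWithinAt_mem_closedBall (a := ⟨a, ha.le⟩) (K := ⟨a, ha.le⟩)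
      (L := ⟨a, ha.le⟩) (f := fun t e ↦ F (x₀ + t • (y - x₀), e) (y - x₀))
      (fun t ht ↦ (hLip y hy t ht).mono hcl) (fun e he t ht ↦ ?_) (fun t ht e he ↦ ?_) le_rfl
    · have he' := mem_ball_iff_norm.1 (hcl he)
      have hx : ‖x₀ + t • (y - x₀) - x₀‖ < r :=
      (hγ y hy t ht).trans_le (by simp only [a] at *; linarith)
      have hc := (hB _ (hb₁ _ (mem _ e hx he'))).1.continuousAt
      have : ContinuousAt (fun t : ℝ ↦ F (x₀ + t • (y - x₀), e)) t :=
        ContinuousAt.comp (f := fun t : ℝ ↦ (x₀ + t • (y - x₀), e)) hc (by fun_prop)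
      exact (this.clm_apply continuousAt_const).continuousWithinAt
    · have he' := mem_ball_iff_norm.1 (hcl he)
      have hx : ‖x₀ + t • (y - x₀) - x₀‖ < r :=
      (hγ y hy t ht).trans_le (by simp only [a] at *; linarith)
      have hy' := (mem_ball_iff_norm.1 hy).le
      calc _ ≤ ‖F (x₀ + t • (y - x₀), e)‖ * ‖y - x₀‖ := ContinuousLinearMap.le_opNorm _ _
        _ ≤ M * δ := by gcongr; exact (hB _ (hb₁ _ (mem _ e hx he'))).2.1
        _ = _ := by rw [hMδ]; rfl
  choose! α hα₀ hαmem hα using hsol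
  have hαIci : ∀ y ∈ ball x₀ δ, ∀ t ∈ Ico (0 : ℝ) 1,
      HasDerivWithinAt (α y) (F (x₀ + t • (y - x₀), α y t) (y - x₀)) (Ici t) t := fun y hy t ht ↦
    (hα y hy t (Ico_subset_Icc_self ht)).mono_of_mem_nhdsWithin (Icc_mem_nhdsGE_of_mem ht)
  have hcurve : ∀ y ∈ ball x₀ δ, ∀ t ∈ Icc (0 : ℝ) 1,
      (x₀ + t • (y - x₀), α y t) ∈ ball (x₀, e₀) r := by
    intro y hy t ht
    have := mem_closedBall_iff_norm.1 (hαmem y hy t)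
    exact mem _ _ ((hγ y hy t ht).trans_le (by simp only [a] at *; linarith))
      (this.trans_lt (by simp only [a]; linarith))
  have hCzero : ∀ y ∈ ball x₀ δ, ∀ t ∈ Icc (0 : ℝ) 1, C (x₀ + t • (y - x₀), α y t) = 0 := by
    intro y hy
    have hd : ∀ t ∈ Icc (0 : ℝ) 1, ∀ s : Set ℝ,
        HasDerivWithinAt (α y) (F (x₀ + t • (y - x₀), α y t) (y - x₀)) s t →
        HasDerivWithinAt (fun t : ℝ ↦ C (x₀ + t • (y - x₀), α y t))
          (fderiv ℝ C (x₀ + t • (y - x₀), α y t)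
            (y - x₀, F (x₀ + t • (y - x₀), α y t) (y - x₀))) s t := by
      intro t ht s hs
      have h1 : HasDerivWithinAt (fun t : ℝ ↦ x₀ + t • (y - x₀)) (y - x₀) s t := by
        simpa using ((hasDerivAt_id t).smul_const (y - x₀)).const_add x₀ |>.hasDerivWithinAt
      exact (hB₂ _ (hb₂ _ (hcurve y hy t ht))).1.1.hasFDerivAt.comp_hasDerivWithinAt t
        (h1.prodMk hs)
    refine eq_zero_of_abs_deriv_le_mul_abs_self_of_eq_zero_right (K := M₀ * ‖y - x₀‖)
      (fun t ht ↦ (hd t ht _ (hα y hy t ht)).continuousWithinAt)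
      (fun t ht ↦ hd t (Ico_subset_Icc_self ht) _ (hαIci y hy t ht)) ?_ ?_
    · simpa [hα₀ y hy] using hC₀
    · exact fun t ht ↦ (hB₂ _ (hb₂ _ (hcurve y hy t (Ico_subset_Icc_self ht)))).1.2 _
  have hone : ∀ y : X, x₀ + (1 : ℝ) • (y - x₀) = y := fun y ↦ by simp
  have h1mem : (1 : ℝ) ∈ Icc (0 : ℝ) 1 := by simp
  refine ⟨ball x₀ δ, isOpen_ball, mem_ball_self hδ, fun y ↦ α y 1, ?_, fun y hy ↦ ⟨?_, ?_, ?_⟩⟩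
  · have hx₀ := mem_ball_self (x := x₀) hδ
    have := constant_of_derivWithin_zero (f := α x₀) (a := 0) (b := 1)
      (fun t ht ↦ (hα x₀ hx₀ t ht).differentiableWithinAt)
      (fun t ht ↦ by
        rw [(hα x₀ hx₀ t (Ico_subset_Icc_self ht)).derivWithin
          (uniqueDiffOn_Icc zero_lt_one t (Ico_subset_Icc_self ht))]
        simp) 1 h1mem
    simpa [hα₀ x₀ hx₀] using this
  · have := (hB₂ _ (hb₂ _ (hcurve y hy 1 h1mem))).2.2
    rwa [hone] at this
  · have := hCzero y hy 1 h1mem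
    rwa [hone] at this
  · set B := M * M + M * M ^ 2 * δ
    have main : ∀ᶠ z in 𝓝 y, ‖α z 1 - α y 1 - F (y, α y 1) (z - y)‖ ≤
        (B / a * (Real.exp a - 1)) * ‖z - y‖ ^ 2 := by
      have hz1 : ∀ᶠ z in 𝓝 y, z ∈ ball x₀ δ := isOpen_ball.mem_nhds hy
      have hz2 : ∀ᶠ z in 𝓝 y, z ∈ ball y δ := ball_mem_nhds y hδ
      filter_upwards [hz1, hz2] with z hz hzy
      set h := z - y
      have hh : ‖h‖ < δ := mem_ball_iff_norm.1 hzy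
      have hMh : M * ‖h‖ ≤ a := by rw [← hMδ]; gcongr
      set w := y - x₀
      have hw : z - x₀ = w + h := by simp only [w, h]; abel
      set p : ℝ → X × E := fun t ↦ (x₀ + t • w, α y t)
      have hp : ∀ t ∈ Icc (0 : ℝ) 1, p t ∈ ball (x₀, e₀) r := hcurve y hy
      have hFp : ∀ t ∈ Icc (0 : ℝ) 1, ‖F (p t) h‖ ≤ M * ‖h‖ := fun t ht ↦
        (ContinuousLinearMap.le_opNorm _ _).trans
          (mul_le_mul_of_nonneg_right (hB _ (hb₁ _ (hp t ht))).2.1 (norm_nonneg _))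
      set φ : ℝ → E := fun t ↦ α y t + t • F (p t) h
      have hφ : ∀ t ∈ Icc (0 : ℝ) 1, ∀ s : Set ℝ, HasDerivWithinAt (α y) (F (p t) w) s t →
          HasDerivWithinAt φ (F (p t) w + (t • fderiv ℝ F (p t) (w, F (p t) w) h
            + (1 : ℝ) • F (p t) h)) s t := by
        intro t ht s hs
        have h1 : HasDerivWithinAt (fun t : ℝ ↦ x₀ + t • w) w s t := by
          simpa using ((hasDerivAt_id t).smul_const w).const_add x₀ |>.hasDerivWithinAt
        have h2 : HasDerivWithinAt (fun t ↦ F (p t)) (fderiv ℝ F (p t) (w, F (p t) w)) s t :=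
          (hB _ (hb₁ _ (hp t ht))).1.hasFDerivAt.comp_hasDerivWithinAt t (h1.prodMk hs)
        have h3 : HasDerivWithinAt (fun t ↦ F (p t) h)
            (fderiv ℝ F (p t) (w, F (p t) w) h) s t := by
          simpa using h2.clm_apply (hasDerivWithinAt_const t s h)
        exact hs.add ((hasDerivWithinAt_id t s).smul h3)
      have hφmem : ∀ t ∈ Icc (0 : ℝ) 1, φ t ∈ ball e₀ r := by
        intro t ht
        have h1 := mem_closedBall_iff_norm.1 (hαmem y hy t)
        have h2 : ‖t • F (p t) h‖ ≤ a := by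
          rw [norm_smul, Real.norm_of_nonneg ht.1]
          exact (mul_le_of_le_one_left (norm_nonneg _) ht.2).trans ((hFp t ht).trans hMh)
        rw [mem_ball_iff_norm]
        calc ‖φ t - e₀‖ = ‖(α y t - e₀) + t • F (p t) h‖ := by simp only [φ]; congr 1; abel
          _ ≤ a + a := (norm_add_le _ _).trans (add_le_add h1 h2)
          _ < r := by simp only [a]; linarith
      have key := dist_le_of_approx_trajectories_ODE_of_mem (a := 0) (b := 1)
        (K := ⟨a, ha.le⟩) (δ := 0) (εf := 0) (εg := B * ‖h‖ ^ 2)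
        (v := fun t e ↦ F (x₀ + t • (z - x₀), e) (z - x₀)) (s := fun _ ↦ ball e₀ r)
        (f := α z) (g := φ) (fun t ht ↦ hLip z hz t (Ico_subset_Icc_self ht))
        (fun t ht ↦ (hα z hz t ht).continuousWithinAt) (hαIci z hz) (fun t _ ↦ by simp)
        (fun t _ ↦ closedBall_subset_ball (by simp only [a]; linarith) (hαmem z hz t))
        (fun t ht ↦ (hφ t ht _ (hα y hy t ht)).continuousWithinAt)
        (fun t ht ↦ hφ t (Ico_subset_Icc_self ht) _ (hαIci y hy t ht))
        (fun t ht' ↦ ?_) (fun t ht ↦ hφmem t (Ico_subset_Icc_self ht))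
        (by simp [φ, hα₀ y hy, hα₀ z hz]) 1 h1mem
      · have e1 : φ 1 = α y 1 + F (y, α y 1) h := by simp [φ, p, w]
        rw [e1, dist_eq_norm, gronwallBound_of_K_ne_0 (by exact ha.ne')] at key
        calc _ = ‖α z 1 - (α y 1 + F (y, α y 1) h)‖ := by congr 1; abel
          _ ≤ _ := key
          _ = _ := by
            change 0 * _ + (0 + B * ‖h‖ ^ 2) / a * (Real.exp (a * (1 - 0)) - 1) = _
            simp only [sub_zero, mul_one, zero_mul, zero_add]; ring
      · have ht := Ico_subset_Icc_self ht'
        set k : X × E := (h, F (p t) h)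
        have hk : ‖k‖ ≤ M * ‖h‖ := by
          rw [Prod.norm_mk]
          exact max_le (le_mul_of_one_le_left (norm_nonneg _) hM) (hFp t ht)
        have hq : (x₀ + t • (z - x₀), φ t) = p t + t • k := by
          simp only [p, k, φ, hw, smul_add, Prod.smul_mk, Prod.mk_add_mk, add_assoc]
        have hqmem : p t + t • k ∈ ball (x₀, e₀) r := by
          rw [← hq]
          exact mem _ _ ((hγ z hz t ht).trans_le (by simp only [a] at *; linarith))
            (mem_ball_iff_norm.1 (hφmem t ht))
        have hfl := (hB₂ _ (hb₂ _ (hp t ht))).2.1 (hCzero y hy t ht) w h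
        have hBp := hB _ (hb₁ _ (hp t ht))
        have hR := (hBp.2.2.2 _ (hb₁ _ hqmem)).2
        rw [add_sub_cancel_left] at hR
        set R := F (p t + t • k) - F (p t) - fderiv ℝ F (p t) (t • k)
        have htk : ‖t • k‖ ≤ M * ‖h‖ := by
          rw [norm_smul, Real.norm_of_nonneg ht.1]
          exact (mul_le_of_le_one_left (norm_nonneg _) ht.2).trans hk
        have hwh : ‖w + h‖ ≤ δ := by
          rw [← hw]; exact (mem_ball_iff_norm.1 hz).le
        have hRn : ‖R (w + h)‖ ≤ M * (M * ‖h‖) ^ 2 * δ := by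
          refine (ContinuousLinearMap.le_opNorm _ _).trans ?_
          gcongr
          exact hR.trans (by gcongr)
        have hDn : ‖fderiv ℝ F (p t) (t • k) h‖ ≤ M * (M * ‖h‖) * ‖h‖ := by
          refine (ContinuousLinearMap.le_opNorm _ _).trans ?_
          gcongr
          refine (ContinuousLinearMap.le_opNorm _ _).trans ?_
          gcongr
          exact hBp.2.2.1
        change dist _ (F (x₀ + t • (z - x₀), φ t) (z - x₀)) ≤ _
        rw [hq, hw, dist_eq_norm, hfl]
        have : F (p t) w + (t • fderiv ℝ F (p t) k w + (1 : ℝ) • F (p t) h)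
            - F (p t + t • k) (w + h) = -(fderiv ℝ F (p t) (t • k) h + R (w + h)) := by
          simp only [R, sub_apply, map_add, map_smul,
            smul_apply, one_smul]
          abel
        rw [this, norm_neg]
        calc _ ≤ M * (M * ‖h‖) * ‖h‖ + M * (M * ‖h‖) ^ 2 * δ :=
              (norm_add_le _ _).trans (add_le_add hDn hRn)
          _ = _ := by simp only [B]; ring
    change HasFDerivAt _ (F (y, α y 1)) y
    rw [hasFDerivAt_iff_isLittleO]
    refine Asymptotics.IsBigO.trans_isLittleO (g := fun z ↦ ‖z - y‖ ^ 2)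
      (Asymptotics.IsBigO.of_bound (B / a * (Real.exp a - 1)) ?_) ?_
    · filter_upwards [main] with z hz
      simpa using hz
    · exact Asymptotics.isLittleO_pow_sub_sub y one_lt_two

section TensorAlgebra

open Finset

variable {ι : Type*} [Fintype ι]

theorem sum_sum_mul_swap (u v : ι → ℝ) (W : ι → ι → ℝ) :
    ∑ h, ∑ k, u h * (v k * W h k) = ∑ h, ∑ k, v h * (u k * W k h) := by
  rw [sum_comm]
  exact sum_congr rfl fun h _ ↦ sum_congr rfl fun k _ ↦ by ring

theorem sum_sum_mul_assoc (u v : ι → ℝ) (W : ι → ι → ℝ) :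
    ∑ h, ∑ k, u h * (W h k * v k) = ∑ h, ∑ k, u k * W k h * v h := by
  rw [sum_comm]
  exact sum_congr rfl fun h _ ↦ sum_congr rfl fun k _ ↦ by ring

/-- The curvature acts trivially on a parallel curvature tensor: the algebraic part of the
argument, in which `dG` and `dR` stand for first derivatives of `G` and `R`. -/
theorem curvature_act_curvature_eq_zero {G : ι → ι → ι → ℝ} {dG R : ι → ι → ι → ι → ℝ}
    {dR : ι → ι → ι → ι → ι → ℝ} {f g b c d e : ι}
    (hR : ∀ a b c d, R a b c d = dG a b d c - dG b a d c +
      ∑ e, (G b d e * G a e c - G a d e * G b e c))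
    (hdR : ∀ f b c d e, dR f b c d e = ∑ h, (G f b h * R h c d e + G f c h * R b h d e
      - G f h d * R b c h e + G f e h * R b c d h))
    (hsymm :
      ∑ h, (dG g f b h * R h c d e + G f b h * dR g h c d e
        + (dG g f c h * R b h d e + G f c h * dR g b h d e)
        - (dG g f h d * R b c h e + G f h d * dR g b c h e)
        + (dG g f e h * R b c d h + G f e h * dR g b c d h)) =
      ∑ h, (dG f g b h * R h c d e + G g b h * dR f h c d e
        + (dG f g c h * R b h d e + G g c h * dR f b h d e)
        - (dG f g h d * R b c h e + G g h d * dR f b c h e)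
        + (dG f g e h * R b c d h + G g e h * dR f b c d h))) :
    ∑ h, (R f g h b * R h c d e + R f g h c * R b h d e - R f g d h * R b c h e
      + R f g h e * R b c d h) = 0 := by
  have e1 : ∀ h, R f g h b = dG f g b h - dG g f b h + ∑ k, (G g b k * G f k h - G f b k * G g k h) :=
    fun h ↦ hR _ _ _ _
  have e2 : ∀ h, R f g h c = dG f g c h - dG g f c h + ∑ k, (G g c k * G f k h - G f c k * G g k h) :=
    fun h ↦ hR _ _ _ _
  have e3 : ∀ h, R f g d h = dG f g h d - dG g f h d + ∑ k, (G g h k * G f k d - G f h k * G g k d) :=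
    fun h ↦ hR _ _ _ _
  have e4 : ∀ h, R f g h e = dG f g e h - dG g f e h + ∑ k, (G g e k * G f k h - G f e k * G g k h) :=
    fun h ↦ hR _ _ _ _
  simp only [e1, e2, e3, e4]
  clear e1 e2 e3 e4 hR
  simp only [hdR] at hsymm
  clear hdR
  simp only [mul_sum, sum_mul, mul_add, mul_sub, add_mul, sub_mul, sum_add_distrib,
    sum_sub_distrib] at hsymm ⊢
  have s1 := sum_sum_mul_assoc (G f b) (fun k ↦ R k c d e) (G g)
  have s1' := sum_sum_mul_assoc (G g b) (fun k ↦ R k c d e) (G f)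
  have s2 := sum_sum_mul_assoc (G f c) (fun k ↦ R b k d e) (G g)
  have s2' := sum_sum_mul_assoc (G g c) (fun k ↦ R b k d e) (G f)
  have s3 := sum_sum_mul_assoc (fun k ↦ G f k d) (fun k ↦ R b c k e) (fun h k ↦ G g k h)
  have s3' := sum_sum_mul_assoc (fun k ↦ G g k d) (fun k ↦ R b c k e) (fun h k ↦ G f k h)
  have s4 := sum_sum_mul_assoc (G f e) (fun k ↦ R b c d k) (G g)
  have s4' := sum_sum_mul_assoc (G g e) (fun k ↦ R b c d k) (G f)
  have t12 := sum_sum_mul_swap (G f b) (G g c) (fun h k ↦ R h k d e)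
  have t13 := sum_sum_mul_swap (G f b) (fun k ↦ G g k d) (fun h k ↦ R h c k e)
  have t14 := sum_sum_mul_swap (G f b) (G g e) (fun h k ↦ R h c d k)
  have t21 := sum_sum_mul_swap (G f c) (G g b) (fun h k ↦ R k h d e)
  have t23 := sum_sum_mul_swap (G f c) (fun k ↦ G g k d) (fun h k ↦ R b h k e)
  have t24 := sum_sum_mul_swap (G f c) (G g e) (fun h k ↦ R b h d k)
  have t31 := sum_sum_mul_swap (fun k ↦ G f k d) (G g b) (fun h k ↦ R k c h e)
  have t32 := sum_sum_mul_swap (fun k ↦ G f k d) (G g c) (fun h k ↦ R b k h e)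
  have t34 := sum_sum_mul_swap (fun k ↦ G f k d) (G g e) (fun h k ↦ R b c h k)
  have t41 := sum_sum_mul_swap (G f e) (G g b) (fun h k ↦ R k c d h)
  have t42 := sum_sum_mul_swap (G f e) (G g c) (fun h k ↦ R b k d h)
  have t43 := sum_sum_mul_swap (G f e) (fun k ↦ G g k d) (fun h k ↦ R b c k h)
  have c3 : ∀ A B : ι → ι → ℝ, ∑ h, ∑ k, A h k * B k d * R b c h e =
      ∑ h, ∑ k, B k d * A h k * R b c h e := fun A B ↦
    sum_congr rfl fun h _ ↦ sum_congr rfl fun k _ ↦ by ring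
  have c3a := c3 (G f) (G g)
  have c3b := c3 (G g) (G f)
  linarith

/-- Integrability of the prolonged system, first component. -/
theorem prolong_integrable_fst {G : ι → ι → ι → ℝ} {dG R : ι → ι → ι → ι → ℝ}
    (σ : ι → ℝ) (μ : ι → ι → ℝ) (f g b : ι)
    (hR : ∀ a b c d, R a b c d = dG a b d c - dG b a d c +
      ∑ e, (G b d e * G a e c - G a d e * G b e c))
    (hG : ∀ a b c, G a b c = G b a c) (hdG : ∀ f a b c, dG f a b c = dG f b a c) :
    (∑ d, R g b d f * σ d + ∑ e, (G f g e * μ e b + G f b e * μ g e)) +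
        ∑ e, (dG f g b e * σ e + G g b e * (μ f e + ∑ d, G f e d * σ d)) =
      (∑ d, R f b d g * σ d + ∑ e, (G g f e * μ e b + G g b e * μ f e)) +
        ∑ e, (dG g f b e * σ e + G f b e * (μ g e + ∑ d, G g e d * σ d)) := by
  have bianchi : ∀ d, R g b d f = R f b d g - (dG f g b d - dG g f b d +
      ∑ e, (G g b e * G f e d - G f b e * G g e d)) := by
    intro d
    rw [hR g b, hR f b, hdG b f g, hdG f b g, hdG g b f]
    have h : ∑ e, (G b f e * G g e d - G g f e * G b e d) =
        ∑ e, (G b g e * G f e d - G f g e * G b e d) -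
          ∑ e, (G g b e * G f e d - G f b e * G g e d) := by
      rw [← sum_sub_distrib]
      refine sum_congr rfl fun e _ ↦ ?_
      rw [hG b f, hG g f, hG b g]; ring
    rw [h]; ring
  simp only [bianchi, hG g f]
  simp only [mul_sum, sum_mul, mul_add, add_mul, sub_mul, sum_add_distrib,
    sum_sub_distrib]
  have s1 := sum_sum_mul_assoc (G g b) σ (G f)
  have s2 := sum_sum_mul_assoc (G f b) σ (G g)
  linarith

/-- Integrability of the prolonged system, second component. -/
theorem prolong_integrable_snd {G : ι → ι → ι → ℝ} {dG R : ι → ι → ι → ι → ℝ}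
    {dR : ι → ι → ι → ι → ι → ℝ} (σ : ι → ℝ) (μ : ι → ι → ℝ) (f g b c : ι)
    (hR : ∀ a b c d, R a b c d = dG a b d c - dG b a d c +
      ∑ e, (G b d e * G a e c - G a d e * G b e c))
    (hdR : ∀ f b c d e, dR f b c d e = ∑ h, (G f b h * R h c d e + G f c h * R b h d e
      - G f h d * R b c h e + G f e h * R b c d h))
    (hG : ∀ a b c, G a b c = G b a c) (hμ : ∀ b c, μ b c + μ c b = 0)
    (hK : ∀ a b c d, ∑ e, (R a b e c * μ d e - R a b e d * μ c e
      + R c d e a * μ b e - R c d e b * μ a e) = 0) :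
    ∑ d, (dR f b c d g * σ d + R b c d g * (μ f d + ∑ e, G f d e * σ e)) +
        ∑ e, (dG f g b e * μ e c +
            G g b e * (∑ d, R e c d f * σ d + ∑ h, (G f e h * μ h c + G f c h * μ e h)) +
          (dG f g c e * μ b e +
            G g c e * (∑ d, R b e d f * σ d + ∑ h, (G f b h * μ h e + G f e h * μ b h)))) =
      ∑ d, (dR g b c d f * σ d + R b c d f * (μ g d + ∑ e, G g d e * σ e)) +
        ∑ e, (dG g f b e * μ e c +
            G f b e * (∑ d, R e c d g * σ d + ∑ h, (G g e h * μ h c + G g c h * μ e h)) +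
          (dG g f c e * μ b e +
            G f c e * (∑ d, R b e d g * σ d + ∑ h, (G g b h * μ h e + G g e h * μ b h)))) := by
  have hK' := hK b c f g
  have hb : ∑ e, R f g e b * μ c e = -∑ e, (dG f g b e - dG g f b e +
      ∑ k, (G g b k * G f k e - G f b k * G g k e)) * μ e c := by
    rw [← sum_neg_distrib]
    refine sum_congr rfl fun e _ ↦ ?_
    rw [hR, show μ c e = -μ e c by linarith [hμ c e]]; ring
  have hc : ∑ e, R f g e c * μ b e = ∑ e, (dG f g c e - dG g f c e +
      ∑ k, (G g c k * G f k e - G f c k * G g k e)) * μ b e :=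
    sum_congr rfl fun e _ ↦ by rw [hR]
  simp only [sum_add_distrib, sum_sub_distrib] at hK'
  rw [hb, hc] at hK'
  simp only [hdR, hG g f]
  clear hR hdR hb hc
  simp only [mul_sum, sum_mul, mul_add, add_mul, sub_mul, sum_add_distrib,
    sum_sub_distrib] at hK' ⊢
  have r1 : ∀ f g, ∑ h, ∑ k, G g b h * (R h c k f * σ k) = ∑ h, ∑ k, G g b k * R k c h f * σ h :=
    fun f g ↦ sum_sum_mul_assoc (G g b) σ (fun h k ↦ R h c k f)
  have r2 : ∀ f g, ∑ h, ∑ k, G g c h * (R b h k f * σ k) = ∑ h, ∑ k, G g c k * R b k h f * σ h :=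
    fun f g ↦ sum_sum_mul_assoc (G g c) σ (fun h k ↦ R b h k f)
  have r3 : ∀ f g, ∑ h, ∑ k, R b c h g * (G f h k * σ k) = ∑ h, ∑ k, G f k h * R b c k g * σ h := by
    intro f g
    rw [sum_comm]
    exact sum_congr rfl fun h _ ↦ sum_congr rfl fun k _ ↦ by ring
  have r4 : ∀ f g, ∑ h, ∑ k, G g b h * (G f h k * μ k c) = ∑ h, ∑ k, G g b k * G f k h * μ h c :=
    fun f g ↦ sum_sum_mul_assoc (G g b) (fun k ↦ μ k c) (G f)
  have r5 : ∀ f g, ∑ h, ∑ k, G g c h * (G f h k * μ b k) = ∑ h, ∑ k, G g c k * G f k h * μ b h :=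
    fun f g ↦ sum_sum_mul_assoc (G g c) (μ b) (G f)
  have r6 : ∀ f g, ∑ h, ∑ k, G g b h * (G f c k * μ h k) = ∑ h, ∑ k, G f c h * (G g b k * μ k h) :=
    fun f g ↦ sum_sum_mul_swap (G g b) (G f c) μ
  linarith [r1 f g, r1 g f, r2 f g, r2 g f, r3 f g, r3 g f, r4 f g, r4 g f, r5 f g, r5 g f,
    r6 f g, r6 g f]

theorem curvature_contract_derivative {G : ι → ι → ι → ℝ} {R : ι → ι → ι → ι → ℝ}
    {dR : ι → ι → ι → ι → ι → ℝ} (σ : ι → ℝ) (μ : ι → ι → ℝ) (f a b c d : ι)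
    (hdR : ∀ f b c d e, dR f b c d e = ∑ h, (G f b h * R h c d e + G f c h * R b h d e
      - G f h d * R b c h e + G f e h * R b c d h)) :
    ∑ e, (dR f a b e c * μ d e + R a b e c * (∑ h, R d e h f * σ h +
        ∑ h, (G f d h * μ h e + G f e h * μ d h))) =
      ∑ h, (G f a h * ∑ e, R h b e c * μ d e + G f b h * ∑ e, R a h e c * μ d e
        + G f c h * ∑ e, R a b e h * μ d e + G f d h * ∑ e, R a b e c * μ h e)
      + ∑ h, (∑ e, R a b e c * R d e h f) * σ h := by
  simp only [hdR]
  simp only [mul_sum, sum_mul, mul_add, add_mul, sub_mul, sum_add_distrib,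
    sum_sub_distrib]
  have comm3 : ∀ A B : ι → ι → ℝ, (∀ h k, A h k = B k h) → ∑ h, ∑ k, A h k = ∑ h, ∑ k, B h k := by
    intro A B h
    rw [sum_comm]
    exact sum_congr rfl fun _ _ ↦ sum_congr rfl fun _ _ ↦ h _ _
  have q1 := comm3 (fun e h ↦ G f a h * R h b e c * μ d e)
    (fun h e ↦ G f a h * (R h b e c * μ d e)) (fun _ _ ↦ by ring)
  have q2 := comm3 (fun e h ↦ G f b h * R a h e c * μ d e)
    (fun h e ↦ G f b h * (R a h e c * μ d e)) (fun _ _ ↦ by ring)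
  have q3 := comm3 (fun e h ↦ G f c h * R a b e h * μ d e)
    (fun h e ↦ G f c h * (R a b e h * μ d e)) (fun _ _ ↦ by ring)
  have q4 := comm3 (fun e h ↦ R a b e c * (G f d h * μ h e))
    (fun h e ↦ G f d h * (R a b e c * μ h e)) (fun _ _ ↦ by ring)
  have q5 := comm3 (fun e h ↦ R a b e c * (G f e h * μ d h))
    (fun e h ↦ G f h e * R a b h c * μ d e) (fun _ _ ↦ by ring)
  have q6 := comm3 (fun e h ↦ R a b e c * (R d e h f * σ h))
    (fun h e ↦ R a b e c * R d e h f * σ h) (fun _ _ ↦ by ring)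
  linarith

/-- The expression defining `Kmem` satisfies a linear homogeneous equation along the prolonged
system. -/
theorem constraint_derivative {G : ι → ι → ι → ℝ} {R : ι → ι → ι → ι → ℝ}
    {dR : ι → ι → ι → ι → ι → ℝ} {K : ι → ι → ι → ι → ℝ}
    (σ : ι → ℝ) (μ : ι → ι → ℝ) (f a b c d : ι)
    (hdR : ∀ f b c d e, dR f b c d e = ∑ h, (G f b h * R h c d e + G f c h * R b h d e
      - G f h d * R b c h e + G f e h * R b c d h))
    (hRanti : ∀ a b c d, R a b c d = -R b a c d)
    (hRR : ∀ f g b c d e, ∑ h, (R f g h b * R h c d e + R f g h c * R b h d e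
      - R f g d h * R b c h e + R f g h e * R b c d h) = 0)
    (hK : ∀ a b c d, K a b c d = ∑ e, (R a b e c * μ d e - R a b e d * μ c e
      + R c d e a * μ b e - R c d e b * μ a e)) :
    ∑ e, (
      (dR f a b e c * μ d e + R a b e c * (∑ h, R d e h f * σ h +
        ∑ h, (G f d h * μ h e + G f e h * μ d h)))
      - (dR f a b e d * μ c e + R a b e d * (∑ h, R c e h f * σ h +
        ∑ h, (G f c h * μ h e + G f e h * μ c h)))
      + (dR f c d e a * μ b e + R c d e a * (∑ h, R b e h f * σ h +
        ∑ h, (G f b h * μ h e + G f e h * μ b h)))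
      - (dR f c d e b * μ a e + R c d e b * (∑ h, R a e h f * σ h +
        ∑ h, (G f a h * μ h e + G f e h * μ a h)))) =
      ∑ h, (G f a h * K h b c d + G f b h * K a h c d
        + G f c h * K a b h d + G f d h * K a b c h) := by
  have hz : ∑ h, (∑ e, R a b e c * R d e h f) * σ h - ∑ h, (∑ e, R a b e d * R c e h f) * σ h
      + ∑ h, (∑ e, R c d e a * R b e h f) * σ h
      - ∑ h, (∑ e, R c d e b * R a e h f) * σ h = 0 := by
    rw [← sum_sub_distrib, ← sum_add_distrib, ← sum_sub_distrib]
    refine sum_eq_zero fun h _ ↦ ?_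
    have h1 := hRR a b c d h f
    have h2 := hRR c d a b h f
    simp only [hRanti _ d h f, hRanti _ b h f] at h1 h2
    simp only [sum_add_distrib, sum_sub_distrib, mul_neg, sum_neg_distrib] at h1 h2
    have h3 : ∑ e, R c d h e * R a b e f = ∑ e, R a b e f * R c d h e :=
      sum_congr rfl fun _ _ ↦ mul_comm _ _
    have h4 : ∑ e, R a b h e * R c d e f = ∑ e, R c d e f * R a b h e :=
      sum_congr rfl fun _ _ ↦ mul_comm _ _
    rw [← sub_mul, ← add_mul, ← sub_mul]
    convert zero_mul (σ h)
    linarith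
  have q1 := curvature_contract_derivative σ μ f a b c d hdR
  have q2 := curvature_contract_derivative σ μ f a b d c hdR
  have q3 := curvature_contract_derivative σ μ f c d a b hdR
  have q4 := curvature_contract_derivative σ μ f c d b a hdR
  rw [sum_sub_distrib, sum_add_distrib, sum_sub_distrib, q1, q2, q3, q4]
  simp only [hK, sum_add_distrib, sum_sub_distrib, mul_add, mul_sub]
  linarith

end TensorAlgebra

section LineDeriv

variable {P : Type*} [NormedAddCommGroup P] [NormedSpace ℝ P] {f g : P → ℝ} {f' g' : ℝ} {p v : P}

theorem HasLineDerivAt.fun_add (hf : HasLineDerivAt ℝ f f' p v) (hg : HasLineDerivAt ℝ g g' p v) :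
    HasLineDerivAt ℝ (fun q ↦ f q + g q) (f' + g') p v :=
  HasDerivAt.fun_add hf hg

theorem HasLineDerivAt.fun_sub (hf : HasLineDerivAt ℝ f f' p v) (hg : HasLineDerivAt ℝ g g' p v) :
    HasLineDerivAt ℝ (fun q ↦ f q - g q) (f' - g') p v :=
  HasDerivAt.fun_sub hf hg

theorem HasLineDerivAt.fun_mul (hf : HasLineDerivAt ℝ f f' p v) (hg : HasLineDerivAt ℝ g g' p v) :
    HasLineDerivAt ℝ (fun q ↦ f q * g q) (f' * g p + f p * g') p v := by
  have := HasDerivAt.fun_mul hf hg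
  simp only [zero_smul, add_zero] at this
  exact this

theorem HasLineDerivAt.fun_sum {ι : Type*} [Fintype ι] {f : ι → P → ℝ} {f' : ι → ℝ}
    (hf : ∀ i, HasLineDerivAt ℝ (f i) (f' i) p v) :
    HasLineDerivAt ℝ (fun q ↦ ∑ i, f i q) (∑ i, f' i) p v :=
  HasDerivAt.fun_sum fun i _ ↦ hf i

end LineDeriv

/-- A solution of a first order total differential equation with smooth right-hand side is
smooth. -/
theorem contDiffOn_of_hasFDerivAt_comp {X E : Type*} [NormedAddCommGroup X] [NormedSpace ℝ X]
    [NormedAddCommGroup E] [NormedSpace ℝ E] {F : X × E → X →L[ℝ] E} {N : Set (X × E)}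
    (hF : ContDiffOn ℝ ∞ F N) {V : Set X} (hV : IsOpen V) {ψ : X → E}
    (hψN : ∀ x ∈ V, (x, ψ x) ∈ N) (hψ : ∀ x ∈ V, HasFDerivAt ψ (F (x, ψ x)) x) :
    ContDiffOn ℝ ∞ ψ V := by
  rw [contDiffOn_infty]
  intro k
  induction k with
  | zero =>
    exact contDiffOn_zero.2 fun x hx ↦ (hψ x hx).continuousAt.continuousWithinAt
  | succ k ih =>
    refine (contDiffOn_succ_iff_fderiv_of_isOpen (n := k) hV).2
      ⟨fun x hx ↦ (hψ x hx).differentiableAt.differentiableWithinAt, by simp, ?_⟩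
    refine ((hF.of_le (by exact_mod_cast le_top)).comp
      (contDiffOn_id.prodMk ih) hψN).congr fun x hx ↦ (hψ x hx).fderiv

section Connection

variable {n : ℕ}

theorem ContDiffAt.pd {f : (Fin n → ℝ) → ℝ} {x : Fin n → ℝ} (hf : ContDiffAt ℝ ∞ f x)
    (a : Fin n) : ContDiffAt ℝ ∞ (pd a f) x :=
  (hf.fderiv_right (m := ∞) (by simp)).clm_apply contDiffAt_const

theorem hasLineDerivAt_pd {f : (Fin n → ℝ) → ℝ} {x : Fin n → ℝ} (hf : ContDiffAt ℝ ∞ f x)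
    (a : Fin n) : HasLineDerivAt ℝ f (pd a f x) x (Pi.single a 1) :=
  (hf.differentiableAt (by simp)).hasFDerivAt.hasLineDerivAt _

theorem pd_comm {f : (Fin n → ℝ) → ℝ} {x : Fin n → ℝ} (hf : ContDiffAt ℝ ∞ f x) (a b : Fin n) :
    pd a (pd b f) x = pd b (pd a f) x := by
  have hd : DifferentiableAt ℝ (fderiv ℝ f) x :=
    (hf.fderiv_right (m := ∞) (by simp)).differentiableAt (by simp)
  have h : ∀ a b, pd a (pd b f) x = fderiv ℝ (fderiv ℝ f) x (Pi.single a 1) (Pi.single b 1) := by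
    intro a b
    change fderiv ℝ (fun y ↦ fderiv ℝ f y (Pi.single b 1)) x (Pi.single a 1) = _
    rw [fderiv_clm_apply hd (by fun_prop)]
    simp
  rw [h, h]
  exact (hf.isSymmSndFDerivAt (by simpa using ENat.LEInfty.out)) _ _

theorem contDiffAt_curv {Γ : Fin n → Fin n → Fin n → (Fin n → ℝ) → ℝ} {x : Fin n → ℝ}
    (hΓ : ∀ a b c, ContDiffAt ℝ ∞ (Γ a b c) x) (a b c d : Fin n) :
    ContDiffAt ℝ ∞ (curv Γ a b c d) x := by
  have h := fun a b c d ↦ (hΓ b c d).pd a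
  unfold curv
  fun_prop

theorem curv_antisymm (Γ : Fin n → Fin n → Fin n → (Fin n → ℝ) → ℝ) (a b c d : Fin n)
    (x : Fin n → ℝ) : curv Γ a b c d x = -curv Γ b a c d x := by
  unfold curv
  rw [neg_add, ← Finset.sum_neg_distrib]
  simp only [neg_sub]

theorem pd_curv_of_covR_eq_zero {Γ : Fin n → Fin n → Fin n → (Fin n → ℝ) → ℝ} {x : Fin n → ℝ}
    (h : ∀ a b c d e, covR Γ a b c d e x = 0) (f b c d e : Fin n) :
    pd f (curv Γ b c d e) x = ∑ h, (Γ f b h x * curv Γ h c d e x + Γ f c h x * curv Γ b h d e x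
      - Γ f h d x * curv Γ b c h e x + Γ f e h x * curv Γ b c d h x) := by
  have := h f b c d e
  unfold covR at this
  simp only [Finset.sum_add_distrib, Finset.sum_sub_distrib]
  linarith

/-- On a locally symmetric space the curvature operators annihilate the curvature tensor. -/
theorem curv_act_curv_eq_zero {Γ : Fin n → Fin n → Fin n → (Fin n → ℝ) → ℝ} {x : Fin n → ℝ}
    (hΓ : ∀ᶠ y in 𝓝 x, ∀ a b c, ContDiffAt ℝ ∞ (Γ a b c) y)
    (hcov : ∀ᶠ y in 𝓝 x, ∀ a b c d e, covR Γ a b c d e y = 0) (f g b c d e : Fin n) :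
    ∑ h, (curv Γ f g h b x * curv Γ h c d e x + curv Γ f g h c x * curv Γ b h d e x
      - curv Γ f g d h x * curv Γ b c h e x + curv Γ f g h e x * curv Γ b c d h x) = 0 := by
  have hR := fun a b c d ↦ contDiffAt_curv hΓ.self_of_nhds a b c d
  have hΓx := hΓ.self_of_nhds
  have key : ∀ f g, pd g (pd f (curv Γ b c d e)) x = ∑ h,
      (pd g (Γ f b h) x * curv Γ h c d e x + Γ f b h x * pd g (curv Γ h c d e) x
        + (pd g (Γ f c h) x * curv Γ b h d e x + Γ f c h x * pd g (curv Γ b h d e) x)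
        - (pd g (Γ f h d) x * curv Γ b c h e x + Γ f h d x * pd g (curv Γ b c h e) x)
        + (pd g (Γ f e h) x * curv Γ b c d h x + Γ f e h x * pd g (curv Γ b c d h) x)) := by
    intro f g
    refine (hasLineDerivAt_pd ((hR b c d e).pd f) g).unique
      (HasLineDerivAt.congr_of_eventuallyEq (HasLineDerivAt.fun_sum fun h ↦ ?_)
        (hcov.mono fun y hy ↦ pd_curv_of_covR_eq_zero hy f b c d e))
    have hΓ' := fun a b c ↦ hasLineDerivAt_pd (hΓx a b c) g
    have hR' := fun a b c d ↦ hasLineDerivAt_pd (hR a b c d) g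
    exact ((((hΓ' _ _ _).fun_mul (hR' _ _ _ _)).fun_add ((hΓ' _ _ _).fun_mul (hR' _ _ _ _))).fun_sub
      ((hΓ' _ _ _).fun_mul (hR' _ _ _ _))).fun_add ((hΓ' _ _ _).fun_mul (hR' _ _ _ _))
  have hs := pd_comm (hR b c d e) g f
  rw [key, key] at hs
  exact curvature_act_curvature_eq_zero (G := fun a b c ↦ Γ a b c x)
    (dG := fun f a b c ↦ pd f (Γ a b c) x) (R := fun a b c d ↦ curv Γ a b c d x)
    (dR := fun f a b c d ↦ pd f (curv Γ a b c d) x) (fun _ _ _ _ ↦ rfl)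
    (pd_curv_of_covR_eq_zero hcov.self_of_nhds) hs

/-- Components along `∂_a` of the prolongation `∇_a σ_b = μ_{ab}`, `∇_a μ_{bc} = R_{bc}ᵈ_a σ_d`
of the Killing equation. -/
def prolong (Γ : Fin n → Fin n → Fin n → (Fin n → ℝ) → ℝ) (a : Fin n)
    (p : (Fin n → ℝ) × (Fin n → ℝ) × (Fin n → Fin n → ℝ)) : (Fin n → ℝ) × (Fin n → Fin n → ℝ) :=
  (fun b ↦ p.2.2 a b + ∑ e, Γ a b e p.1 * p.2.1 e,
    fun b c ↦ ∑ d, curv Γ b c d a p.1 * p.2.1 d +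
      ∑ e, (Γ a b e p.1 * p.2.2 e c + Γ a c e p.1 * p.2.2 b e))

/-- The prolonged Killing system as a form with values in continuous linear maps. -/
def prolongForm (Γ : Fin n → Fin n → Fin n → (Fin n → ℝ) → ℝ)
    (p : (Fin n → ℝ) × (Fin n → ℝ) × (Fin n → Fin n → ℝ)) :
    (Fin n → ℝ) →L[ℝ] (Fin n → ℝ) × (Fin n → Fin n → ℝ) :=
  ∑ a, (ContinuousLinearMap.proj (R := ℝ) (φ := fun _ : Fin n ↦ ℝ) a).smulRight (prolong Γ a p)

/-- The conditions defining `Kmem`, as functions on the space of values `(x, σ, μ)`. -/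
def killingConstraint (Γ : Fin n → Fin n → Fin n → (Fin n → ℝ) → ℝ)
    (p : (Fin n → ℝ) × (Fin n → ℝ) × (Fin n → Fin n → ℝ)) :
    (Fin n → Fin n → ℝ) × (Fin n → Fin n → Fin n → Fin n → ℝ) :=
  (fun b c ↦ p.2.2 b c + p.2.2 c b,
    fun a b c d ↦ ∑ e, (curv Γ a b e c p.1 * p.2.2 d e - curv Γ a b e d p.1 * p.2.2 c e
      + curv Γ c d e a p.1 * p.2.2 b e - curv Γ c d e b p.1 * p.2.2 a e))

theorem prolongForm_apply (Γ : Fin n → Fin n → Fin n → (Fin n → ℝ) → ℝ)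
    (p : (Fin n → ℝ) × (Fin n → ℝ) × (Fin n → Fin n → ℝ)) (h : Fin n → ℝ) :
    prolongForm Γ p h = ∑ a, h a • prolong Γ a p := by
  simp [prolongForm]

variable {Γ : Fin n → Fin n → Fin n → (Fin n → ℝ) → ℝ}
  {p : (Fin n → ℝ) × (Fin n → ℝ) × (Fin n → Fin n → ℝ)}

theorem contDiffAt_prolong (hΓ : ∀ a b c, ContDiffAt ℝ ∞ (Γ a b c) p.1) (a : Fin n) :
    ContDiffAt ℝ ∞ (prolong Γ a) p := by
  have h1 : ∀ a b c, ContDiffAt ℝ ∞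
      (fun q : (Fin n → ℝ) × (Fin n → ℝ) × (Fin n → Fin n → ℝ) ↦ Γ a b c q.1) p :=
    fun a b c ↦ (hΓ a b c).comp p contDiffAt_fst
  have h2 : ∀ a b c d, ContDiffAt ℝ ∞
      (fun q : (Fin n → ℝ) × (Fin n → ℝ) × (Fin n → Fin n → ℝ) ↦ curv Γ a b c d q.1) p :=
    fun a b c d ↦ (contDiffAt_curv hΓ a b c d).comp p contDiffAt_fst
  unfold prolong
  fun_prop

theorem contDiffAt_prolongForm (hΓ : ∀ a b c, ContDiffAt ℝ ∞ (Γ a b c) p.1) :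
    ContDiffAt ℝ ∞ (prolongForm Γ) p := by
  unfold prolongForm
  exact ContDiffAt.sum fun a _ ↦ contDiffAt_const.smulRight (contDiffAt_prolong hΓ a)

theorem contDiffAt_killingConstraint (hΓ : ∀ a b c, ContDiffAt ℝ ∞ (Γ a b c) p.1) :
    ContDiffAt ℝ ∞ (killingConstraint Γ) p := by
  have h2 : ∀ a b c d, ContDiffAt ℝ ∞
      (fun q : (Fin n → ℝ) × (Fin n → ℝ) × (Fin n → Fin n → ℝ) ↦ curv Γ a b c d q.1) p :=
    fun a b c d ↦ (contDiffAt_curv hΓ a b c d).comp p contDiffAt_fst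
  unfold killingConstraint
  fun_prop

theorem hasLineDerivAt_comp_fst {f : (Fin n → ℝ) → ℝ} (hf : ContDiffAt ℝ ∞ f p.1) (a : Fin n)
    (e : (Fin n → ℝ) × (Fin n → Fin n → ℝ)) :
    HasLineDerivAt ℝ (fun q : (Fin n → ℝ) × (Fin n → ℝ) × (Fin n → Fin n → ℝ) ↦ f q.1)
      (pd a f p.1) p (Pi.single a 1, e) :=
  hasLineDerivAt_pd hf a

theorem hasLineDerivAt_snd_fst (v : (Fin n → ℝ) × (Fin n → ℝ) × (Fin n → Fin n → ℝ))
    (b : Fin n) :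
    HasLineDerivAt ℝ (fun q : (Fin n → ℝ) × (Fin n → ℝ) × (Fin n → Fin n → ℝ) ↦ q.2.1 b)
      (v.2.1 b) p v := by
  have h : HasDerivAt (fun t : ℝ ↦ p.2.1 b + t * v.2.1 b) (v.2.1 b) 0 := by
    simpa using ((hasDerivAt_id (0 : ℝ)).mul_const (v.2.1 b)).const_add (p.2.1 b)
  exact h

theorem hasLineDerivAt_snd_snd (v : (Fin n → ℝ) × (Fin n → ℝ) × (Fin n → Fin n → ℝ))
    (b c : Fin n) :
    HasLineDerivAt ℝ (fun q : (Fin n → ℝ) × (Fin n → ℝ) × (Fin n → Fin n → ℝ) ↦ q.2.2 b c)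
      (v.2.2 b c) p v := by
  have h : HasDerivAt (fun t : ℝ ↦ p.2.2 b c + t * v.2.2 b c) (v.2.2 b c) 0 := by
    simpa using ((hasDerivAt_id (0 : ℝ)).mul_const (v.2.2 b c)).const_add (p.2.2 b c)
  exact h

end Connection
section Integrability

variable {n : ℕ} {Γ : Fin n → Fin n → Fin n → (Fin n → ℝ) → ℝ}
  {p : (Fin n → ℝ) × (Fin n → ℝ) × (Fin n → Fin n → ℝ)}

theorem fderiv_prolong_fst (hΓ : ∀ a b c, ContDiffAt ℝ ∞ (Γ a b c) p.1) (f g b : Fin n) :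
    (fderiv ℝ (prolong Γ g) p (Pi.single f 1, prolong Γ f p)).1 b =
      (prolong Γ f p).2 g b +
        ∑ e, (pd f (Γ g b e) p.1 * p.2.1 e + Γ g b e p.1 * (prolong Γ f p).1 e) := by
  have hd := ((contDiffAt_prolong hΓ g).differentiableAt (by simp)).hasFDerivAt
  have h₁ := (((ContinuousLinearMap.proj (R := ℝ) (φ := fun _ : Fin n ↦ ℝ) b).comp
    (ContinuousLinearMap.fst ℝ _ (Fin n → Fin n → ℝ))).hasFDerivAt.comp p hd).hasLineDerivAt
      (Pi.single f 1, prolong Γ f p)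
  exact h₁.unique ((hasLineDerivAt_snd_snd _ g b).fun_add (HasLineDerivAt.fun_sum fun e ↦
    (hasLineDerivAt_comp_fst (hΓ g b e) f _).fun_mul (hasLineDerivAt_snd_fst _ e)))

theorem fderiv_prolong_snd (hΓ : ∀ a b c, ContDiffAt ℝ ∞ (Γ a b c) p.1) (f g b c : Fin n) :
    (fderiv ℝ (prolong Γ g) p (Pi.single f 1, prolong Γ f p)).2 b c =
      ∑ d, (pd f (curv Γ b c d g) p.1 * p.2.1 d + curv Γ b c d g p.1 * (prolong Γ f p).1 d) +
        ∑ e, (pd f (Γ g b e) p.1 * p.2.2 e c + Γ g b e p.1 * (prolong Γ f p).2 e c +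
          (pd f (Γ g c e) p.1 * p.2.2 b e + Γ g c e p.1 * (prolong Γ f p).2 b e)) := by
  have hd := ((contDiffAt_prolong hΓ g).differentiableAt (by simp)).hasFDerivAt
  have h₁ := ((((ContinuousLinearMap.proj (R := ℝ) (φ := fun _ : Fin n ↦ ℝ) c).comp
    (ContinuousLinearMap.proj (R := ℝ) (φ := fun _ : Fin n ↦ Fin n → ℝ) b)).comp
    (ContinuousLinearMap.snd ℝ (Fin n → ℝ) _)).hasFDerivAt.comp p hd).hasLineDerivAt
      (Pi.single f 1, prolong Γ f p)
  exact h₁.unique ((HasLineDerivAt.fun_sum fun d ↦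
    (hasLineDerivAt_comp_fst (contDiffAt_curv hΓ b c d g) f _).fun_mul
      (hasLineDerivAt_snd_fst _ d)).fun_add (HasLineDerivAt.fun_sum fun e ↦
    ((hasLineDerivAt_comp_fst (hΓ g b e) f _).fun_mul (hasLineDerivAt_snd_snd _ e c)).fun_add
      ((hasLineDerivAt_comp_fst (hΓ g c e) f _).fun_mul (hasLineDerivAt_snd_snd _ b e))))

theorem fderiv_killingConstraint_fst (hΓ : ∀ a b c, ContDiffAt ℝ ∞ (Γ a b c) p.1)
    (f b c : Fin n) :
    (fderiv ℝ (killingConstraint Γ) p (Pi.single f 1, prolong Γ f p)).1 b c =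
      ∑ e, (Γ f b e p.1 * (killingConstraint Γ p).1 e c +
        Γ f c e p.1 * (killingConstraint Γ p).1 b e) := by
  have hd := ((contDiffAt_killingConstraint hΓ).differentiableAt (by simp)).hasFDerivAt
  have h₁ := ((((ContinuousLinearMap.proj (R := ℝ) (φ := fun _ : Fin n ↦ ℝ) c).comp
    (ContinuousLinearMap.proj (R := ℝ) (φ := fun _ : Fin n ↦ Fin n → ℝ) b)).comp
    (ContinuousLinearMap.fst ℝ _ (Fin n → Fin n → Fin n → Fin n → ℝ))).hasFDerivAt.comp p
      hd).hasLineDerivAt (Pi.single f 1, prolong Γ f p)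
  refine (h₁.unique ((hasLineDerivAt_snd_snd _ b c).fun_add
    (hasLineDerivAt_snd_snd _ c b))).trans ?_
  simp only [prolong, killingConstraint, curv_antisymm Γ c b, mul_add, Finset.sum_add_distrib,
    neg_mul, Finset.sum_neg_distrib]
  ring

theorem fderiv_killingConstraint_snd (hΓ : ∀ a b c, ContDiffAt ℝ ∞ (Γ a b c) p.1)
    (hcov : ∀ a b c d e, covR Γ a b c d e p.1 = 0)
    (hRR : ∀ f g b c d e, ∑ h, (curv Γ f g h b p.1 * curv Γ h c d e p.1
      + curv Γ f g h c p.1 * curv Γ b h d e p.1 - curv Γ f g d h p.1 * curv Γ b c h e p.1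
      + curv Γ f g h e p.1 * curv Γ b c d h p.1) = 0) (f a b c d : Fin n) :
    (fderiv ℝ (killingConstraint Γ) p (Pi.single f 1, prolong Γ f p)).2 a b c d =
      ∑ e, (Γ f a e p.1 * (killingConstraint Γ p).2 e b c d +
        Γ f b e p.1 * (killingConstraint Γ p).2 a e c d +
        Γ f c e p.1 * (killingConstraint Γ p).2 a b e d +
        Γ f d e p.1 * (killingConstraint Γ p).2 a b c e) := by
  have hd := ((contDiffAt_killingConstraint hΓ).differentiableAt (by simp)).hasFDerivAt
  have h₁ := ((((ContinuousLinearMap.proj (R := ℝ) (φ := fun _ : Fin n ↦ ℝ) d).comp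
    ((ContinuousLinearMap.proj (R := ℝ) (φ := fun _ : Fin n ↦ Fin n → ℝ) c).comp
    ((ContinuousLinearMap.proj (R := ℝ) (φ := fun _ : Fin n ↦ Fin n → Fin n → ℝ) b).comp
    (ContinuousLinearMap.proj (R := ℝ) (φ := fun _ : Fin n ↦ Fin n → Fin n → Fin n → ℝ) a)))).comp
    (ContinuousLinearMap.snd ℝ (Fin n → Fin n → ℝ) _)).hasFDerivAt.comp p
      hd).hasLineDerivAt (Pi.single f 1, prolong Γ f p)
  have hR := fun a b c d ↦
    hasLineDerivAt_comp_fst (contDiffAt_curv hΓ a b c d) f (prolong Γ f p)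
  have hμ := hasLineDerivAt_snd_snd (p := p) (Pi.single f 1, prolong Γ f p)
  refine (h₁.unique (HasLineDerivAt.fun_sum fun e ↦
    ((((hR a b e c).fun_mul (hμ d e)).fun_sub ((hR a b e d).fun_mul (hμ c e))).fun_add
      ((hR c d e a).fun_mul (hμ b e))).fun_sub ((hR c d e b).fun_mul (hμ a e)))).trans ?_
  exact constraint_derivative (G := fun a b c ↦ Γ a b c p.1)
    (R := fun a b c d ↦ curv Γ a b c d p.1) (dR := fun f a b c d ↦ pd f (curv Γ a b c d) p.1)
    (K := (killingConstraint Γ p).2) p.2.1 p.2.2 f a b c d (pd_curv_of_covR_eq_zero hcov)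
    (fun _ _ _ _ ↦ curv_antisymm Γ _ _ _ _ _) hRR (fun _ _ _ _ ↦ rfl)

theorem fderiv_prolong_comm (hΓ : ∀ a b c, ContDiffAt ℝ ∞ (Γ a b c) p.1)
    (hsym : ∀ᶠ x in 𝓝 p.1, ∀ a b c, Γ a b c x = Γ b a c x)
    (hcov : ∀ a b c d e, covR Γ a b c d e p.1 = 0) (hp : killingConstraint Γ p = 0)
    (f g : Fin n) :
    fderiv ℝ (prolong Γ g) p (Pi.single f 1, prolong Γ f p) =
      fderiv ℝ (prolong Γ f) p (Pi.single g 1, prolong Γ g p) := by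
  have hG : ∀ a b c, Γ a b c p.1 = Γ b a c p.1 := hsym.self_of_nhds
  have hdG : ∀ f a b c, pd f (Γ a b c) p.1 = pd f (Γ b a c) p.1 := by
    intro f a b c
    have : Γ a b c =ᶠ[𝓝 p.1] Γ b a c := hsym.mono fun x hx ↦ hx a b c
    rw [pd, pd, this.fderiv_eq]
  refine Prod.ext (funext fun b ↦ ?_) (funext fun b ↦ funext fun c ↦ ?_)
  · rw [fderiv_prolong_fst hΓ, fderiv_prolong_fst hΓ]
    exact prolong_integrable_fst (G := fun a b c ↦ Γ a b c p.1)
      (dG := fun f a b c ↦ pd f (Γ a b c) p.1) (R := fun a b c d ↦ curv Γ a b c d p.1)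
      p.2.1 p.2.2 f g b (fun _ _ _ _ ↦ rfl) hG hdG
  · rw [fderiv_prolong_snd hΓ, fderiv_prolong_snd hΓ]
    have hp₁ := fun b c ↦ congrFun (congrFun (congrArg Prod.fst hp) b) c
    have hp₂ := fun a b c d ↦
      congrFun (congrFun (congrFun (congrFun (congrArg Prod.snd hp) a) b) c) d
    exact prolong_integrable_snd (G := fun a b c ↦ Γ a b c p.1)
      (dG := fun f a b c ↦ pd f (Γ a b c) p.1) (R := fun a b c d ↦ curv Γ a b c d p.1)
      (dR := fun f a b c d ↦ pd f (curv Γ a b c d) p.1)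
      p.2.1 p.2.2 f g b c (fun _ _ _ _ ↦ rfl) (pd_curv_of_covR_eq_zero hcov) hG hp₁ hp₂

theorem prod_prolongForm (h : Fin n → ℝ) :
    (h, prolongForm Γ p h) = ∑ f, h f • ((Pi.single f 1 : Fin n → ℝ), prolong Γ f p) := by
  rw [prolongForm_apply]
  refine Prod.ext ?_ ?_
  · simp only [Prod.fst_sum, Prod.smul_fst]
    exact pi_eq_sum_univ' h
  · simp only [Prod.snd_sum, Prod.smul_snd]

theorem fderiv_prolongForm (hΓ : ∀ a b c, ContDiffAt ℝ ∞ (Γ a b c) p.1)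
    (v : (Fin n → ℝ) × (Fin n → ℝ) × (Fin n → Fin n → ℝ)) (k : Fin n → ℝ) :
    fderiv ℝ (prolongForm Γ) p v k = ∑ g, k g • fderiv ℝ (prolong Γ g) p v := by
  have hF := (contDiffAt_prolongForm hΓ).differentiableAt (by simp)
  have h₁ := (hF.hasFDerivAt.clm_apply (hasFDerivAt_const k p))
  have h₂ : HasFDerivAt (fun q ↦ prolongForm Γ q k) (∑ g, k g • fderiv ℝ (prolong Γ g) p) p := by
    simp only [prolongForm_apply]
    exact HasFDerivAt.fun_sum fun g _ ↦
      (((contDiffAt_prolong hΓ g).differentiableAt (by simp)).hasFDerivAt.const_smul (k g))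
  have := congrArg (fun L ↦ L v) (h₁.unique h₂)
  simpa using this

theorem fderiv_prolongForm_comm (hΓ : ∀ a b c, ContDiffAt ℝ ∞ (Γ a b c) p.1)
    (hsym : ∀ᶠ x in 𝓝 p.1, ∀ a b c, Γ a b c x = Γ b a c x)
    (hcov : ∀ a b c d e, covR Γ a b c d e p.1 = 0) (hp : killingConstraint Γ p = 0)
    (h k : Fin n → ℝ) :
    fderiv ℝ (prolongForm Γ) p (h, prolongForm Γ p h) k =
      fderiv ℝ (prolongForm Γ) p (k, prolongForm Γ p k) h := by
  rw [fderiv_prolongForm hΓ, fderiv_prolongForm hΓ]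
  simp only [prod_prolongForm, map_sum, map_smul, Finset.smul_sum]
  rw [Finset.sum_comm]
  refine Finset.sum_congr rfl fun f _ ↦ Finset.sum_congr rfl fun g _ ↦ ?_
  rw [fderiv_prolong_comm hΓ hsym hcov hp f g, smul_comm]

end Integrability
section Constraint

variable {n : ℕ} {Γ : Fin n → Fin n → Fin n → (Fin n → ℝ) → ℝ}
  {p : (Fin n → ℝ) × (Fin n → ℝ) × (Fin n → Fin n → ℝ)}

theorem norm_fderiv_killingConstraint_le (hΓ : ∀ a b c, ContDiffAt ℝ ∞ (Γ a b c) p.1)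
    (hcov : ∀ a b c d e, covR Γ a b c d e p.1 = 0)
    (hRR : ∀ f g b c d e, ∑ h, (curv Γ f g h b p.1 * curv Γ h c d e p.1
      + curv Γ f g h c p.1 * curv Γ b h d e p.1 - curv Γ f g d h p.1 * curv Γ b c h e p.1
      + curv Γ f g h e p.1 * curv Γ b c d h p.1) = 0)
    {M : ℝ} (hM₀ : 0 ≤ M) (hM : ∀ a b c, |Γ a b c p.1| ≤ M) (h : Fin n → ℝ) :
    ‖fderiv ℝ (killingConstraint Γ) p (h, prolongForm Γ p h)‖ ≤
      n * (n * (4 * M)) * ‖h‖ * ‖killingConstraint Γ p‖ := by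
  set κ := ‖killingConstraint Γ p‖ with hκ
  have hκ₀ : 0 ≤ κ := norm_nonneg _
  have hC₁ : ∀ b c, |(killingConstraint Γ p).1 b c| ≤ κ := fun b c ↦
    ((norm_le_pi_norm ((killingConstraint Γ p).1 b) c).trans (norm_le_pi_norm _ b)).trans
      (norm_fst_le _)
  have hC₂ : ∀ a b c d, |(killingConstraint Γ p).2 a b c d| ≤ κ := fun a b c d ↦
    ((((norm_le_pi_norm ((killingConstraint Γ p).2 a b c) d).trans (norm_le_pi_norm _ c)).trans
      (norm_le_pi_norm _ b)).trans (norm_le_pi_norm _ a)).trans (norm_snd_le _)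
  have hmul : ∀ {x y : ℝ}, |x| ≤ M → |y| ≤ κ → |x * y| ≤ M * κ := fun hx hy ↦ by
    rw [abs_mul]; gcongr
  have hsum : ∀ {u : Fin n → ℝ}, (∀ e, |u e| ≤ 4 * M * κ) → ‖∑ e, u e‖ ≤ n * (4 * M) * κ := by
    intro u hu
    refine (norm_sum_le_of_le _ fun e _ ↦ hu e).trans_eq ?_
    rw [Finset.sum_const, Finset.card_univ, Fintype.card_fin, nsmul_eq_mul]; ring
  have hv : ∀ f, ‖fderiv ℝ (killingConstraint Γ) p (Pi.single f 1, prolong Γ f p)‖ ≤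
      n * (4 * M) * κ := by
    intro f
    have hr : 0 ≤ n * (4 * M) * κ := by positivity
    refine norm_prod_le_iff.2 ⟨(pi_norm_le_iff_of_nonneg hr).2 fun b ↦
      (pi_norm_le_iff_of_nonneg hr).2 fun c ↦ ?_, (pi_norm_le_iff_of_nonneg hr).2 fun a ↦
      (pi_norm_le_iff_of_nonneg hr).2 fun b ↦ (pi_norm_le_iff_of_nonneg hr).2 fun c ↦
      (pi_norm_le_iff_of_nonneg hr).2 fun d ↦ ?_⟩
    · rw [fderiv_killingConstraint_fst hΓ]
      refine hsum fun e ↦ ?_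
      have := mul_nonneg hM₀ hκ₀
      exact (abs_add_le _ _).trans (by
        linarith [hmul (hM f b e) (hC₁ e c), hmul (hM f c e) (hC₁ b e)])
    · rw [fderiv_killingConstraint_snd hΓ hcov hRR]
      refine hsum fun e ↦ ?_
      refine (abs_add_le _ _).trans ((add_le_add_left ((abs_add_le _ _).trans
        (add_le_add_left (abs_add_le _ _) _)) _).trans ?_)
      linarith [hmul (hM f a e) (hC₂ e b c d), hmul (hM f b e) (hC₂ a e c d),
        hmul (hM f c e) (hC₂ a b e d), hmul (hM f d e) (hC₂ a b c e)]
  rw [prod_prolongForm]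
  simp only [map_sum, map_smul]
  refine (norm_sum_le_of_le (f := fun f ↦ h f •
    fderiv ℝ (killingConstraint Γ) p (Pi.single f 1, prolong Γ f p)) _
    (n := fun _ ↦ ‖h‖ * (n * (4 * M) * κ)) fun f _ ↦ ?_).trans_eq ?_
  · rw [norm_smul]
    exact mul_le_mul (norm_le_pi_norm h f) (hv f) (norm_nonneg _) (norm_nonneg _)
  · rw [Finset.sum_const, Finset.card_univ, Fintype.card_fin, nsmul_eq_mul]; ring

theorem cov1_of_hasFDerivAt {V : (Fin n → ℝ) → (Fin n → ℝ) × (Fin n → Fin n → ℝ)}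
    {x : Fin n → ℝ} (hV : HasFDerivAt V (prolongForm Γ (x, V x)) x) (a b : Fin n) :
    cov1 Γ a (fun b y ↦ (V y).1 b) b x = (V x).2 a b := by
  have h := ((ContinuousLinearMap.proj (R := ℝ) (φ := fun _ : Fin n ↦ ℝ) b).comp
    (ContinuousLinearMap.fst ℝ _ (Fin n → Fin n → ℝ))).hasFDerivAt.comp x hV
  have h₁ : pd a (fun y ↦ (V y).1 b) x = (prolongForm Γ (x, V x) (Pi.single a 1)).1 b :=
    congrArg (fun L ↦ L (Pi.single a 1)) h.fderiv
  have h₂ : prolongForm Γ (x, V x) (Pi.single a 1) = prolong Γ a (x, V x) := by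
    rw [prolongForm_apply, Finset.sum_eq_single a (fun b _ hb ↦ by simp [hb]) (by simp)]
    simp
  rw [cov1, h₁, h₂]
  simp [prolong]

end Constraint

/-- **Local existence of Killing 1-forms with prescribed data on an affine locally
symmetric space.**  For each point `x₀ ∈ U`, covector `v` and antisymmetric form
`m ∈ K_{x₀}`, there is a Killing 1-form near `x₀` with `σ(x₀) = v` and
`∇_a σ_b(x₀) = m_{ab}`. -/
theorem local_killing_one_forms_with_prescribed_data
    {n : ℕ} (hn : 1 ≤ n) (U : Set (Fin n → ℝ)) (hU : IsOpen U)
    (Γ : Fin n → Fin n → Fin n → (Fin n → ℝ) → ℝ)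
    (hΓsmooth : ∀ a b c, ContDiffOn ℝ (⊤ : ℕ∞) (Γ a b c) U)
    (hΓsym : ∀ a b c, ∀ x ∈ U, Γ a b c x = Γ b a c x)
    (hlocsym : ∀ a b c d e, ∀ x ∈ U, covR Γ a b c d e x = 0) :
    ∀ x₀ ∈ U, ∀ (v : Fin n → ℝ) (m : Fin n → Fin n → ℝ), Kmem Γ x₀ m →
      ∃ V : Set (Fin n → ℝ), IsOpen V ∧ x₀ ∈ V ∧ V ⊆ U ∧
        ∃ σ : Fin n → (Fin n → ℝ) → ℝ,
          (∀ b, ContDiffOn ℝ (⊤ : ℕ∞) (σ b) V) ∧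
          (∀ a b, ∀ x ∈ V, cov1 Γ a σ b x + cov1 Γ b σ a x = 0) ∧
          (∀ b, σ b x₀ = v b) ∧
          (∀ a b, cov1 Γ a σ b x₀ = m a b) := by


  intro x₀ hx₀ v m hm
  have hnhds : ∀ x ∈ U, ∀ᶠ y in 𝓝 x, y ∈ U := fun x hx ↦ hU.mem_nhds hx
  have hΓ : ∀ x ∈ U, ∀ a b c, ContDiffAt ℝ ∞ (Γ a b c) x :=
    fun x hx a b c ↦ (hΓsmooth a b c).contDiffAt (hU.mem_nhds hx)
  have hRR : ∀ x ∈ U, ∀ f g b c d e, ∑ h, (curv Γ f g h b x * curv Γ h c d e x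
      + curv Γ f g h c x * curv Γ b h d e x - curv Γ f g d h x * curv Γ b c h e x
      + curv Γ f g h e x * curv Γ b c d h x) = 0 := fun x hx ↦
    curv_act_curv_eq_zero ((hnhds x hx).mono hΓ)
      ((hnhds x hx).mono fun y hy a b c d e ↦ hlocsym a b c d e y hy)
  have hN : U ×ˢ univ ∈ 𝓝 (x₀, (v, m)) :=
    (hU.prod isOpen_univ).mem_nhds ⟨hx₀, mem_univ _⟩
  obtain ⟨M, hM₀, hM⟩ : ∃ M : ℝ, 0 ≤ M ∧ ∀ᶠ x in 𝓝 x₀, ∀ a b c, |Γ a b c x| ≤ M := by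
    refine ⟨∑ a, ∑ b, ∑ c, (|Γ a b c x₀| + 1), by positivity, ?_⟩
    simp only [Filter.eventually_all]
    intro a b c
    have h₁ : ∀ᶠ x in 𝓝 x₀, |Γ a b c x| < |Γ a b c x₀| + 1 :=
      (hΓ x₀ hx₀ a b c).continuousAt.abs.eventually_lt_const (lt_add_one _)
    filter_upwards [h₁] with x hx
    refine hx.le.trans ?_
    refine le_trans ?_ (Finset.single_le_sum (fun _ _ ↦ by positivity) (Finset.mem_univ a))
    refine le_trans ?_ (Finset.single_le_sum (fun _ _ ↦ by positivity) (Finset.mem_univ b))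
    exact Finset.single_le_sum (f := fun c ↦ |Γ a b c x₀| + 1) (fun _ _ ↦ by positivity)
      (Finset.mem_univ c)
  have hfst : Filter.Tendsto Prod.fst (𝓝 (x₀, (v, m))) (𝓝 x₀) := continuous_fst.tendsto _
  obtain ⟨V, hV, hxV, ψ, hψ₀, hψ⟩ := exists_local_solution_of_integrable_on_constraint
    (F := prolongForm Γ) (C := killingConstraint Γ) (e₀ := (v, m)) (M₀ := n * (n * (4 * M)))
    ((contDiffAt_prolongForm (hΓ x₀ hx₀)).of_le ENat.LEInfty.out)
    (by
      refine Prod.ext (funext fun b ↦ funext fun c ↦ ?_)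
        (funext fun a ↦ funext fun b ↦ funext fun c ↦ funext fun d ↦ hm.2 a b c d)
      change m b c + m c b = 0
      rw [hm.1 b c, neg_add_cancel])
    (by
      filter_upwards [hN, hfst.eventually hM] with p hp hMp
      exact ⟨(contDiffAt_killingConstraint (hΓ p.1 hp.1)).differentiableAt (by simp),
        norm_fderiv_killingConstraint_le (hΓ p.1 hp.1)
          (fun a b c d e ↦ hlocsym a b c d e p.1 hp.1) (hRR p.1 hp.1) hM₀ hMp⟩)
    (by
      filter_upwards [hN] with p hp hCp
      exact fderiv_prolongForm_comm (hΓ p.1 hp.1)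
        ((hnhds p.1 hp.1).mono fun y hy a b c ↦ hΓsym a b c y hy)
        (fun a b c d e ↦ hlocsym a b c d e p.1 hp.1) hCp)
    hN
  have hcov : ∀ a b, ∀ x ∈ V, cov1 Γ a (fun b y ↦ (ψ y).1 b) b x = (ψ x).2 a b :=
    fun a b x hx ↦ cov1_of_hasFDerivAt (hψ x hx).2.2 a b
  have hsmooth : ContDiffOn ℝ ∞ ψ V := contDiffOn_of_hasFDerivAt_comp (N := U ×ˢ univ)
    (fun p hp ↦ (contDiffAt_prolongForm (hΓ p.1 hp.1)).contDiffWithinAt) hV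
    (fun x hx ↦ (hψ x hx).1) (fun x hx ↦ (hψ x hx).2.2)
  refine ⟨V, hV, hxV, fun x hx ↦ (hψ x hx).1.1, fun b y ↦ (ψ y).1 b, fun b ↦ ?_, ?_, ?_, ?_⟩
  · exact contDiffOn_pi.1 hsmooth.fst b
  · intro a b x hx
    rw [hcov a b x hx, hcov b a x hx]
    exact congrFun (congrFun (congrArg Prod.fst (hψ x hx).2.1) a) b
  · intro b
    change (ψ x₀).1 b = v b
    rw [hψ₀]
  · intro a b
    rw [hcov a b x₀ hxV, hψ₀]

end
end

section
/- Let V be a real vector space and let W be the space of 5-linear forms X : V⁵ → ℝ satisfying X(a,b,c,d,e) = −X(a,c,b,d,e), X(a,b,c,d,e) = −X(a,b,c,e,d), and X(a,b,c,d,e) + X(a,b,d,e,c) + X(a,b,e,c,d) = 0 (i.e. Λ¹ tensored with tensors having Riemann symmetries). Then the formula Φ(X)(a,b,c,d,e) := X(a,b,c,d,e) − (X(b,c,a,d,e) − X(c,b,a,d,e)) − (X(d,e,a,b,c) − X(e,d,a,b,c)) defines a linear automorphism of W, whose inverse is given by X(a,b,c,d,e) = −(1/3)( Y(a,b,c,d,e)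 + (Y(b,c,a,d,e) − Y(c,b,a,d,e)) + (Y(d,e,a,b,c) − Y(e,d,a,b,c)) ) for Y = Φ(X). -/
noncomputable section

/-- Membership in `W = Λ¹ ⊗ {ρ_{bcde} = ρ_{[bc][de]} : ρ_{b[cde]} = 0}`:
5-linear forms antisymmetric in arguments 2,3 and in arguments 4,5, with vanishing
cyclic sum over the last three arguments. -/
def memW {V : Type*} (X : V → V → V → V → V → ℝ) : Prop :=
  (∀ a b c d e, X a b c d e = - X a c b d e) ∧
  (∀ a b c d e, X a b c d e = - X a b c e d) ∧
  (∀ a b c d e, X a b c d e + X a b d e c + X a b e c d = 0)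

/-- The map `X_{abcde} ↦ X_{abcde} − 2X_{[bc]ade} − 2X_{[de]abc}`. -/
def phiW {V : Type*} (X : V → V → V → V → V → ℝ) : V → V → V → V → V → ℝ :=
  fun a b c d e =>
    X a b c d e - (X b c a d e - X c b a d e) - (X d e a b c - X e d a b c)

/-- The inverse map `Y_{abcde} ↦ −(1/3)(Y_{abcde} + 2Y_{[bc]ade} + 2Y_{[de]abc})`. -/
def psiW {V : Type*} (Y : V → V → V → V → V → ℝ) : V → V → V → V → V → ℝ :=
  fun a b c d e =>
    -(1/3 : ℝ) *
      (Y a b c d e + (Y b c a d e - Y c b a d e) + (Y d e a b c - Y e d a b c))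

/-- The pair symmetry of tensors with Riemann symmetries. -/
theorem memW.pair_symm {V : Type*} {X : V → V → V → V → V → ℝ} (h : memW X)
    (a b c d e : V) : X a b c d e = X a d e b c := by
  obtain ⟨h1, h2, h3⟩ := h
  have := h3 a b c d e
  have := h3 a c d e b
  have := h3 a d e b c
  have := h3 a e b c d
  grind

/-- **The formula `X ↦ X_{abcde} − 2X_{[bc]ade} − 2X_{[de]abc}` is a linear
automorphism of `Λ¹ ⊗ (Riemann symmetries)`, with the stated inverse.** -/
theorem fun_formula_automorphism (V : Type*) [AddCommGroup V] [Module ℝ V] :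
    (∀ X : V → V → V → V → V → ℝ, memW X →
      memW (phiW X) ∧ (∀ a b c d e, psiW (phiW X) a b c d e = X a b c d e)) ∧
    (∀ Y : V → V → V → V → V → ℝ, memW Y →
      memW (psiW Y) ∧ (∀ a b c d e, phiW (psiW Y) a b c d e = Y a b c d e)) := by
  have key : ∀ X : V → V → V → V → V → ℝ, memW X → ∀ a b c d e,
      psiW (phiW X) a b c d e = X a b c d e ∧ phiW (psiW X) a b c d e = X a b c d e := by
    intro X h a b c d e
    have hp := h.pair_symm
    obtain ⟨h1, h2, h3⟩ := h
    simp only [psiW, phiW]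
    constructor <;> grind
  have phi_mem : ∀ X : V → V → V → V → V → ℝ, memW X → memW (phiW X) := by
    intro X h
    have hp := h.pair_symm
    obtain ⟨h1, h2, h3⟩ := h
    refine ⟨fun a b c d e => ?_, fun a b c d e => ?_, fun a b c d e => ?_⟩ <;>
      simp only [phiW] <;> grind
  have psi_mem : ∀ X : V → V → V → V → V → ℝ, memW X → memW (psiW X) := by
    intro X h
    have hp := h.pair_symm
    obtain ⟨h1, h2, h3⟩ := h
    refine ⟨fun a b c d e => ?_, fun a b c d e => ?_, fun a b c d e => ?_⟩ <;>
      simp only [psiW] <;> grind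
  exact ⟨fun X h => ⟨phi_mem X h, fun a b c d e => (key X h a b c d e).1⟩,
    fun Y h => ⟨psi_mem Y h, fun a b c d e => (key Y h a b c d e).2⟩⟩

end
end

section
/- Let V be a real vector space and let φ : V⁵ → ℝ be a 5-linear form which is alternating in its last four arguments and whose total alternation over all five arguments vanishes (φ_{[abcde]} = 0). Define θ(a,b,c,d,e) := (1/2)(φ(a,b,c,d,e) − φ(b,a,c,d,e)). Then φ can be recovered from θ by the formula φ(a,b,c,d,e) = (8/3) · Alt_{bcde}[θ(a,b,c,d,e)], where Alt_{bcde} denotes antisymmetrization over the last four arguments with 1/4! normalization. -/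
noncomputable section

/-- Antisymmetrization (with `1/5!` normalization) of a 5-argument form over all
five of its arguments. -/
def alt5 {V : Type*} (φ : V → V → V → V → V → ℝ) (a b c d e : V) : ℝ :=
  (1/120 : ℝ) * ∑ π : Equiv.Perm (Fin 5),
    ((Equiv.Perm.sign π : ℤ) : ℝ) *
      φ (![a, b, c, d, e] (π 0)) (![a, b, c, d, e] (π 1)) (![a, b, c, d, e] (π 2))
        (![a, b, c, d, e] (π 3)) (![a, b, c, d, e] (π 4))

/-- Antisymmetrization (with `1/4!` normalization) of a 5-argument form over its
last four arguments. -/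
def alt4Last {V : Type*} (θ : V → V → V → V → V → ℝ) (a b c d e : V) : ℝ :=
  (1/24 : ℝ) * ∑ π : Equiv.Perm (Fin 4),
    ((Equiv.Perm.sign π : ℤ) : ℝ) *
      θ a (![b, c, d, e] (π 0)) (![b, c, d, e] (π 1)) (![b, c, d, e] (π 2))
        (![b, c, d, e] (π 3))

/-- A function of `n + 1` arguments that changes sign under adjacent transpositions
transforms by the sign under every permutation. -/
lemma apply_comp_perm_of_adjacent_swap {V : Type*} {n : ℕ} (F : (Fin (n + 1) → V) → ℝ)
    (hF : ∀ v (i : Fin n), F (v ∘ Equiv.swap i.castSucc i.succ) = -F v)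
    (π : Equiv.Perm (Fin (n + 1))) (v : Fin (n + 1) → V) :
    F (v ∘ π) = ((Equiv.Perm.sign π : ℤ) : ℝ) * F v := by
  have hπ : π ∈ Submonoid.closure
      (Set.range fun i : Fin n ↦ Equiv.swap i.castSucc i.succ) := by
    rw [Equiv.Perm.mclosure_swap_castSucc_succ]
    trivial
  induction hπ using Submonoid.closure_induction generalizing v with
  | mem x hx =>
    obtain ⟨i, rfl⟩ := hx
    simp [hF, Equiv.Perm.sign_swap i.castSucc_lt_succ.ne]
  | one => simp
  | mul x y _ _ hx hy =>
    rw [Equiv.Perm.coe_mul, ← Function.comp_assoc, hy, hx, Equiv.Perm.sign_mul]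
    push_cast
    ring

lemma sum_sign_mul_of_alternating {V : Type*} {n : ℕ} (F : (Fin (n + 1) → V) → ℝ)
    (hF : ∀ v (i : Fin n), F (v ∘ Equiv.swap i.castSucc i.succ) = -F v)
    (v : Fin (n + 1) → V) :
    ∑ π : Equiv.Perm (Fin (n + 1)), ((Equiv.Perm.sign π : ℤ) : ℝ) * F (v ∘ π) =
      ((n + 1).factorial : ℝ) * F v := by
  have h (π : Equiv.Perm (Fin (n + 1))) :
      ((Equiv.Perm.sign π : ℤ) : ℝ) * F (v ∘ π) = F v := by
    rw [apply_comp_perm_of_adjacent_swap F hF, ← mul_assoc, ← Int.cast_mul,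
      Int.units_coe_mul_self, Int.cast_one, one_mul]
  simp [h, Fintype.card_perm]

/-- Expansion of an antisymmetrization along the first argument, when the remaining
arguments are already alternating. -/
lemma sum_sign_mul_of_alternating_tail {V : Type*} {n : ℕ}
    (G : V → (Fin (n + 1) → V) → ℝ)
    (hG : ∀ x v (i : Fin n), G x (v ∘ Equiv.swap i.castSucc i.succ) = -G x v)
    (v : Fin (n + 2) → V) :
    ∑ π : Equiv.Perm (Fin (n + 2)),
        ((Equiv.Perm.sign π : ℤ) : ℝ) * G (v (π 0)) (fun i ↦ v (π i.succ)) =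
      ((n + 1).factorial : ℝ) * ∑ p : Fin (n + 2),
        (if p = 0 then 1 else -1) * G (v p) (fun i ↦ v (Equiv.swap 0 p i.succ)) := by
  rw [← Equiv.Perm.decomposeFin.symm.sum_comp, Fintype.sum_prod_type, Finset.mul_sum]
  refine Finset.sum_congr rfl fun p _ ↦ ?_
  rw [mul_left_comm,
    ← sum_sign_mul_of_alternating (G (v p)) (hG _) (fun i ↦ v (Equiv.swap 0 p i.succ)),
    Finset.mul_sum]
  refine Finset.sum_congr rfl fun σ _ ↦ ?_
  rw [Equiv.Perm.decomposeFin.symm_sign]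
  simp only [Equiv.Perm.decomposeFin_symm_apply_zero,
    Equiv.Perm.decomposeFin_symm_apply_succ, Function.comp_def]
  split_ifs <;> simp

/-- **Lemma (mindless algebra).**  If `φ_{abcde} = φ_{a[bcde]}` and `φ_{[abcde]} = 0`,
then `φ` can be recovered from `θ_{abcde} := φ_{[ab]cde}` by
`φ_{abcde} = (8/3) θ_{a[bcde]}`. -/
theorem recover_from_skew (V : Type*) [AddCommGroup V] [Module ℝ V]
    (φ : V → V → V → V → V → ℝ)
    (halt₁ : ∀ a b c d e, φ a b c d e = - φ a c b d e)
    (halt₂ : ∀ a b c d e, φ a b c d e = - φ a b d c e)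
    (halt₃ : ∀ a b c d e, φ a b c d e = - φ a b c e d)
    (htotal : ∀ a b c d e, alt5 φ a b c d e = 0) :
    ∀ a b c d e, φ a b c d e =
      (8/3 : ℝ) * alt4Last
        (fun a' b' c' d' e' => (1/2 : ℝ) * (φ a' b' c' d' e' - φ b' a' c' d' e'))
        a b c d e := by
  intro a b c d e
  have h4 (x : V) (v : Fin 4 → V) (i : Fin 3) :
      (fun w : Fin 4 → V ↦ φ x (w 0) (w 1) (w 2) (w 3))
        (v ∘ Equiv.swap i.castSucc i.succ) = -φ x (v 0) (v 1) (v 2) (v 3) := by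
    fin_cases i
    · exact halt₁ _ _ _ _ _
    · exact halt₂ _ _ _ _ _
    · exact halt₃ _ _ _ _ _
  have h3 (x : V) (v : Fin 3 → V) (i : Fin 2) :
      (fun w : Fin 3 → V ↦ φ x a (w 0) (w 1) (w 2))
        (v ∘ Equiv.swap i.castSucc i.succ) = -φ x a (v 0) (v 1) (v 2) := by
    fin_cases i
    · exact halt₂ _ _ _ _ _
    · exact halt₃ _ _ _ _ _
  have htot : (1/120 : ℝ) * _ = 0 := (congrArg _ (sum_sign_mul_of_alternating_tail
    (fun x w ↦ φ x (w 0) (w 1) (w 2) (w 3)) h4 ![a, b, c, d, e]).symm).trans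
      (htotal a b c d e)
  have hfst : ∑ π : Equiv.Perm (Fin 4), ((Equiv.Perm.sign π : ℤ) : ℝ) *
      φ a (![b, c, d, e] (π 0)) (![b, c, d, e] (π 1)) (![b, c, d, e] (π 2))
        (![b, c, d, e] (π 3)) = (Nat.factorial 4 : ℝ) * φ a b c d e :=
    sum_sign_mul_of_alternating (fun w ↦ φ a (w 0) (w 1) (w 2) (w 3)) (h4 a) ![b, c, d, e]
  have hsnd : ∑ π : Equiv.Perm (Fin 4), ((Equiv.Perm.sign π : ℤ) : ℝ) *
      φ (![b, c, d, e] (π 0)) a (![b, c, d, e] (π 1)) (![b, c, d, e] (π 2))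
        (![b, c, d, e] (π 3)) = (Nat.factorial 3 : ℝ) *
      (φ b a c d e - φ c a b d e - φ d a c b e - φ e a c d b) := by
    refine (sum_sign_mul_of_alternating_tail
      (fun x w ↦ φ x a (w 0) (w 1) (w 2)) h3 ![b, c, d, e]).trans ?_
    congr 1
    rw [Fin.sum_univ_four]
    change 1 * φ b a c d e + -1 * φ c a b d e + -1 * φ d a c b e + -1 * φ e a c d b = _
    ring
  rw [Fin.sum_univ_five] at htot
  change (1/120 : ℝ) * ((Nat.factorial 4 : ℝ) * (1 * φ a b c d e + -1 * φ b a c d e +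
    -1 * φ c b a d e + -1 * φ d b c a e + -1 * φ e b c d a)) = 0 at htot
  have hc := halt₁ c b a d e
  have hd : φ d b c a e = -φ d a c b e := by
    rw [halt₁ d b c a e, halt₂ d c b a e, halt₁ d c a b e, neg_neg]
  have he : φ e b c d a = -φ e a c d b := by
    rw [halt₃ e b c d a, halt₂ e b c a d, halt₁ e b a c d, halt₂ e a b c d, halt₃ e a c b d]
    ring
  unfold alt4Last
  simp only [mul_sub, mul_left_comm _ (1/2 : ℝ), Finset.sum_sub_distrib, ← Finset.mul_sum]
  rw [hfst, hsnd]
  norm_num [Nat.factorial] at htot ⊢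
  linarith

end
end

section
/- Let V be a real vector space, let R be an algebraic curvature operator on V, and let μ : V³ → ℝ be a trilinear form with μ_{bcd} = −μ_{bdc}. Set μ̃_{bcd} := μ_{bcd} − (1/3)(μ_{bcd} + μ_{cdb} + μ_{dbc}), and define the 5-linear form X_{abcde} := R_{bc}^f_d μ_{aef} − R_{bc}^f_e μ_{adf} + R_{de}^f_b μ_{acf} − R_{de}^f_c μ_{abf}. Define, for any trilinear ν with ν_{bcd} = −ν_{bdc}, (R⋄ν)_{abcde} := R_{bc}^f_a ν_{fde} + R_{de}^f_a ν_{fbc} − (1/2) R_{be}^f_a ν_{fcd} − (1/2) R_{cd}^f_a ν_{fbe} + (1/2) R_{bd}^f_a ν_{fce} + (1/2) R_{ce}^f_a ν_{fbd} + (2/3)( R_{a(b}^f_{d)} ν_{(ce)f} − R_{a(c}^f_{d)} ν_{(be)f} − R_{a(b}^f_{e)} ν_{(cd)f} + R_{a(c}^f_{e)} ν_{(bd)f} ) − (2/3)( R_{bc}^f_d ν_{(ea)f} − R_{bc}^f_e ν_{(da)f} + R_{de}^f_b ν_{(ca)f} − R_{de}^f_c ν_{(ba)f} ), where R_{a(b}^f_{d)}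 := (1/2)(R_{ab}^f_d + R_{ad}^f_b) and ν_{(ce)f} := (1/2)(ν_{cef} + ν_{ecf}). Then (R⋄μ̃)_{abcde} = R_{bc}^f_a μ_{fde} + R_{de}^f_a μ_{fbc} − 2 · Alt_{bcde}[ R_{bc}^f_a μ_{fde} ] − (1/3)( X_{abcde} + X_{bacde} − X_{cabde} + X_{daebc} − X_{eadbc} ), where Alt_{bcde} denotes antisymmetrization over the indices b, c, d, e with 1/4! normalization. -/
noncomputable section

variable {V : Type*} [AddCommGroup V] [Module ℝ V]

/-- Antisymmetrization (with `1/4!` normalization) of a 4-argument expression over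
its four arguments. -/
def alt4V (T : V → V → V → V → ℝ) (b c d e : V) : ℝ :=
  (1/24 : ℝ) * ∑ π : Equiv.Perm (Fin 4),
    ((Equiv.Perm.sign π : ℤ) : ℝ) *
      T (![b, c, d, e] (π 0)) (![b, c, d, e] (π 1)) (![b, c, d, e] (π 2))
        (![b, c, d, e] (π 3))

/-- `X_{abcde} := R_{bc}ᶠ_d μ_{aef} − R_{bc}ᶠ_e μ_{adf} + R_{de}ᶠ_b μ_{acf}
  − R_{de}ᶠ_c μ_{abf}`. -/
def keyX (R : V →ₗ[ℝ] V →ₗ[ℝ] V →ₗ[ℝ] V) (μ : V →ₗ[ℝ] V →ₗ[ℝ] V →ₗ[ℝ] ℝ)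
    (a b c d e : V) : ℝ :=
  μ a e (R b c d) - μ a d (R b c e) + μ a c (R d e b) - μ a b (R d e c)

/-- `(R ⋄ ν)_{abcde}`, for `ν` a trilinear form skew in its last two arguments. -/
def RdiaAlg (R : V →ₗ[ℝ] V →ₗ[ℝ] V →ₗ[ℝ] V) (ν : V → V → V → ℝ)
    (a b c d e : V) : ℝ :=
  ν (R b c a) d e + ν (R d e a) b c
  - (1/2 : ℝ) * ν (R b e a) c d - (1/2 : ℝ) * ν (R c d a) b e
  + (1/2 : ℝ) * ν (R b d a) c e + (1/2 : ℝ) * ν (R c e a) b d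
  + (2/3 : ℝ) *
    ( (1/4 : ℝ) * (ν c e (R a b d) + ν e c (R a b d) + ν c e (R a d b) + ν e c (R a d b))
    - (1/4 : ℝ) * (ν b e (R a c d) + ν e b (R a c d) + ν b e (R a d c) + ν e b (R a d c))
    - (1/4 : ℝ) * (ν c d (R a b e) + ν d c (R a b e) + ν c d (R a e b) + ν d c (R a e b))
    + (1/4 : ℝ) * (ν b d (R a c e) + ν d b (R a c e) + ν b d (R a e c) + ν d b (R a e c)) )
  - (2/3 : ℝ) *
    ( (1/2 : ℝ) * (ν e a (R b c d) + ν a e (R b c d))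
    - (1/2 : ℝ) * (ν d a (R b c e) + ν a d (R b c e))
    + (1/2 : ℝ) * (ν c a (R d e b) + ν a c (R d e b))
    - (1/2 : ℝ) * (ν b a (R d e c) + ν a b (R d e c)) )

/-- Antisymmetrization of a 4-argument expression that is skew in its first two and in its last
two arguments. -/
theorem alt4V_of_skew {W : Type*} (T : W → W → W → W → ℝ)
    (h₁ : ∀ x y z w, T x y z w = - T y x z w) (h₂ : ∀ x y z w, T x y z w = - T x y w z)
    (b c d e : W) :
    alt4V T b c d e = (1/6 : ℝ) *
      (T b c d e - T b d c e + T b e c d + T c d b e - T c e b d + T d e b c) := by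
  have hsum : ∀ f : Equiv.Perm (Fin 4) → ℝ, ∑ π, f π =
      ∑ i : Fin 4, ∑ j : Fin 3, ∑ k : Fin 2, f (Equiv.Perm.decomposeFin.symm
        (i, Equiv.Perm.decomposeFin.symm (j, Equiv.Perm.decomposeFin.symm (k, 1)))) := by
    intro f
    rw [← Equiv.Perm.decomposeFin.symm.sum_comp, Fintype.sum_prod_type]
    refine Finset.sum_congr rfl fun i _ => ?_
    rw [← Equiv.Perm.decomposeFin.symm.sum_comp, Fintype.sum_prod_type]
    refine Finset.sum_congr rfl fun j _ => ?_
    rw [← Equiv.Perm.decomposeFin.symm.sum_comp, Fintype.sum_prod_type]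
    refine Finset.sum_congr rfl fun k _ => ?_
    rw [Fintype.sum_unique]
    congr!
  rw [alt4V, hsum]
  have e₂ : ∀ {n : ℕ} (p : Fin (n + 3)) (σ : Equiv.Perm (Fin (n + 2))),
      Equiv.Perm.decomposeFin.symm (p, σ) 2 = Equiv.swap 0 p (σ 1).succ :=
    fun p σ => Equiv.Perm.decomposeFin_symm_apply_succ σ p 1
  have e₃ : ∀ (p : Fin 4) (σ : Equiv.Perm (Fin 3)),
      Equiv.Perm.decomposeFin.symm (p, σ) 3 = Equiv.swap 0 p (σ 2).succ :=
    fun p σ => Equiv.Perm.decomposeFin_symm_apply_succ σ p 2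
  simp [Fin.sum_univ_succ, e₂, e₃, Equiv.swap_apply_def]
  simp only [h₁ c b, h₁ d b, h₁ e b, h₁ d c, h₁ e c, h₁ e d,
    h₂ _ _ c b, h₂ _ _ d b, h₂ _ _ e b, h₂ _ _ d c, h₂ _ _ e c, h₂ _ _ e d]
  ring

/-- **Lemma (key piece).**  For an algebraic curvature operator `R` and a trilinear
form `μ` skew in its last two arguments, with `μ̃ := μ − μ_{[bcd]}` one has
`(R ⋄ μ̃)_{abcde} = R_{bc}ᶠ_a μ_{fde} + R_{de}ᶠ_a μ_{fbc} − 2R_{[bc}ᶠ_{|a}μ_{f|de]}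
− (1/3)(X_{abcde} + X_{bacde} − X_{cabde} + X_{daebc} − X_{eadbc})`. -/
theorem key_piece (R : V →ₗ[ℝ] V →ₗ[ℝ] V →ₗ[ℝ] V)
    (hRskew : ∀ a b c, R a b c = - R b a c)
    (hRbianchi : ∀ a b c, R a b c + R b c a + R c a b = 0)
    (μ : V →ₗ[ℝ] V →ₗ[ℝ] V →ₗ[ℝ] ℝ)
    (hμskew : ∀ b c d, μ b c d = - μ b d c) :
    ∀ a b c d e : V,
      RdiaAlg R
        (fun b' c' d' =>
          μ b' c' d' - (1/3 : ℝ) * (μ b' c' d' + μ c' d' b' + μ d' b' c'))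
        a b c d e
      = μ (R b c a) d e + μ (R d e a) b c
        - 2 * alt4V (fun b' c' d' e' => μ (R b' c' a) d' e') b c d e
        - (1/3 : ℝ) * (keyX R μ a b c d e + keyX R μ b a c d e
            - keyX R μ c a b d e + keyX R μ d a e b c - keyX R μ e a d b c) := by
  intro a b c d e
  have hA := alt4V_of_skew (fun b' c' d' e' => μ (R b' c' a) d' e')
    (fun x y z w => by simp only [hRskew x y, map_neg, LinearMap.neg_apply])
    (fun x y z w => hμskew _ _ _) b c d e
  have hμR : ∀ x p q r y, μ x (R p q r) y = - μ x y (R p q r) := fun x p q r y => hμskew _ _ _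
  have hB : ∀ x y z, R y z x = R x z y - R x y z := fun x y z => by
    have h := hRbianchi x y z
    rw [hRskew z x y] at h
    rw [← sub_eq_zero, ← h]
    abel
  rw [hA]
  simp only [RdiaAlg, keyX, hμR]
  simp only [
    hB a b c, hB a b d, hB a b e, hB a c d, hB a c e, hB a d e, hB b d e, hB c d e, map_sub,
    LinearMap.sub_apply, hμskew _ b a, hμskew _ c a, hμskew _ d a, hμskew _ e a, hμskew _ d b,
    hμskew _ e b, hμskew _ d c, hμskew _ e c]
  ring

end
end

section
/- Let V be a real vector space, let R be an algebraic curvature operator on V, and let μ : V×V → ℝ be an antisymmetric bilinear form. Define X(a,b,c,d) := (1/2)( μ(d, R(a,b)c) − μ(c, R(a,b)d) ) + (1/2)( μ(b, R(c,d)a) − μ(a, R(c,d)b) ), i.e. X_{abcd} = R_{ab}^e_{[c} μ_{d]e} + R_{cd}^e_{[a} μ_{b]e}. Then X has Riemann tensor symmetries: X(a,b,c,d) = −X(b,a,c,d) = −X(a,b,d,c), X(a,b,c,d) = X(c,d,a,b), and X(a,b,c,d) + X(b,c,a,d) + X(c,a,b,d) = 0. -/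
noncomputable section

/-- `X_{abcd} := R_{ab}ᵉ_{[c} μ_{d]e} + R_{cd}ᵉ_{[a} μ_{b]e}` for an algebraic
curvature operator `R` and an antisymmetric bilinear form `μ`. -/
def keyX2 {V : Type*} [AddCommGroup V] [Module ℝ V]
    (R : V →ₗ[ℝ] V →ₗ[ℝ] V →ₗ[ℝ] V) (μ : V →ₗ[ℝ] V →ₗ[ℝ] ℝ)
    (a b c d : V) : ℝ :=
  (1/2 : ℝ) * (μ d (R a b c) - μ c (R a b d)) +
  (1/2 : ℝ) * (μ b (R c d a) - μ a (R c d b))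

/-- **`R_{ab}ᵉ_{[c} μ_{d]e} + R_{cd}ᵉ_{[a} μ_{b]e}` has Riemann tensor symmetries**
for any algebraic curvature operator `R` and antisymmetric bilinear form `μ`. -/
theorem keyX2_riemann_symmetries (V : Type*) [AddCommGroup V] [Module ℝ V]
    (R : V →ₗ[ℝ] V →ₗ[ℝ] V →ₗ[ℝ] V)
    (hRskew : ∀ a b c, R a b c = - R b a c)
    (hRbianchi : ∀ a b c, R a b c + R b c a + R c a b = 0)
    (μ : V →ₗ[ℝ] V →ₗ[ℝ] ℝ)
    (hμskew : ∀ a b, μ a b = - μ b a) :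
    (∀ a b c d, keyX2 R μ a b c d = - keyX2 R μ b a c d) ∧
    (∀ a b c d, keyX2 R μ a b c d = - keyX2 R μ a b d c) ∧
    (∀ a b c d, keyX2 R μ a b c d = keyX2 R μ c d a b) ∧
    (∀ a b c d, keyX2 R μ a b c d + keyX2 R μ b c a d + keyX2 R μ c a b d = 0) := by
  have skew : ∀ x a b c, μ x (R a b c) = - μ x (R b a c) := fun x a b c => by
    rw [hRskew a b c, map_neg]
  have bianchi : ∀ x a b c, μ x (R a b c) + μ x (R b c a) + μ x (R c a b) = 0 :=
    fun x a b c => by rw [← map_add, ← map_add, hRbianchi, map_zero]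
  unfold keyX2
  refine ⟨fun a b c d => ?_, fun a b c d => ?_, fun a b c d => ?_, fun a b c d => ?_⟩
  · linarith [skew d a b c, skew c a b d]
  · linarith [skew b c d a, skew a c d b]
  · ring
  · linarith [bianchi d a b c, bianchi c a b d, bianchi a b c d, bianchi b c a d,
      skew c a d b, skew a b d c, skew b c d a]

end
end

section
/- Let V be a real vector space, let R be an algebraic curvature operator on V, and let σ : V×V → ℝ be a symmetric bilinear form. Define T(a,b,c,d) := (1/2)( σ(b, R(c,d)a) − σ(a, R(c,d)b) ) + (1/2)( σ(d, R(a,b)c) − σ(c, R(a,b)d) ), i.e. T_{abcd} = R_{cd}^e_{[a} σ_{b]e} + R_{ab}^e_{[c} σ_{d]e}. Then T has Riemann tensor symmetries: T(a,b,c,d) = −T(b,a,c,d) = −T(a,b,d,c), T(a,b,c,d) = T(c,d,a,b), and T(a,b,c,d) + T(b,c,a,d) + T(c,a,b,d) = 0. (This is the freedom by which the two lifts (option one) and (option two) of the curvature differ in the prolongation of the Killing 2-tensor equation.) -/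
noncomputable section

/-- `T_{abcd} := R_{cd}ᵉ_{[a} σ_{b]e} + R_{ab}ᵉ_{[c} σ_{d]e}` for an algebraic
curvature operator `R` and a symmetric bilinear form `σ`. -/
def freedomT {V : Type*} [AddCommGroup V] [Module ℝ V]
    (R : V →ₗ[ℝ] V →ₗ[ℝ] V →ₗ[ℝ] V) (σ : V →ₗ[ℝ] V →ₗ[ℝ] ℝ)
    (a b c d : V) : ℝ :=
  (1/2 : ℝ) * (σ b (R c d a) - σ a (R c d b)) +
  (1/2 : ℝ) * (σ d (R a b c) - σ c (R a b d))

/-- **The freedom tensor `R_{cd}ᵉ_{[a} σ_{b]e} + R_{ab}ᵉ_{[c} σ_{d]e}` has Riemann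
tensor symmetries** for any algebraic curvature operator `R` and symmetric bilinear
form `σ`.  (This is the freedom by which the two lifts of curvature differ in the
prolongation of the Killing 2-tensor equation.) -/
theorem freedom_riemann_symmetries (V : Type*) [AddCommGroup V] [Module ℝ V]
    (R : V →ₗ[ℝ] V →ₗ[ℝ] V →ₗ[ℝ] V)
    (hRskew : ∀ a b c, R a b c = - R b a c)
    (hRbianchi : ∀ a b c, R a b c + R b c a + R c a b = 0)
    (σ : V →ₗ[ℝ] V →ₗ[ℝ] ℝ)
    (hσsym : ∀ a b, σ a b = σ b a) :
    (∀ a b c d, freedomT R σ a b c d = - freedomT R σ b a c d) ∧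
    (∀ a b c d, freedomT R σ a b c d = - freedomT R σ a b d c) ∧
    (∀ a b c d, freedomT R σ a b c d = freedomT R σ c d a b) ∧
    (∀ a b c d, freedomT R σ a b c d + freedomT R σ b c a d
      + freedomT R σ c a b d = 0) := by
  have hskew (x a b c : V) : σ x (R a b c) = -σ x (R b a c) := by
    rw [hRskew a b c, map_neg]
  have hbianchi (x a b c : V) : σ x (R a b c) + σ x (R b c a) + σ x (R c a b) = 0 := by
    rw [← map_add, ← map_add, hRbianchi, map_zero]
  simp only [freedomT]
  refine ⟨fun a b c d ↦ ?_, fun a b c d ↦ ?_, fun a b c d ↦ ?_, fun a b c d ↦ ?_⟩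
  · linarith [hskew d a b c, hskew c a b d]
  · linarith [hskew b c d a, hskew a c d b]
  · ring
  · linarith [hbianchi d a b c, hbianchi a b c d, hbianchi b c a d, hbianchi c a b d,
      hskew a b d c, hskew b c d a, hskew c a d b]

end
end

section
/- Let V be a real vector space, let R be an algebraic curvature operator on V, and let σ : V×V → ℝ be a symmetric bilinear form. Define (R◁σ)(a,b,c,d) := (2/3) σ(b, R(c,d)a) − (1/3) σ(d, R(b,c)a) + (1/3) σ(c, R(b,d)a), i.e. (R◁σ)_{abcd} = (2/3)R_{cd}^e_a σ_{be} − (1/3)R_{bc}^e_a σ_{de} + (1/3)R_{bd}^e_a σ_{ce}. Then for all a, b, c, d ∈ V: (i) (R◁σ)(b,c,d,a) + (R◁σ)(b,d,c,a) = σ(c, R(d,a)b) + σ(d, R(c,a)b), i.e. 2(R◁σ)_{b(cd)a} = R_{ca}^f_b σ_{df} + R_{da}^f_b σ_{cf}; and (ii) (1/2)( (R◁σ)(b,c,d,a) + (R◁σ)(b,d,c,a) ) − (1/2)( (R◁σ)(a,c,d,b) + (R◁σ)(a,d,c,b) ) = −(1/2)( σ(d, R(a,b)c) + σ(c, R(a,b)d)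 ), i.e. (R◁σ)_{b(cd)a} − (R◁σ)_{a(cd)b} = −R_{ab}^e_{(c} σ_{d)e}. -/
noncomputable section

/-- `(R ◁ σ)_{abcd} := (2/3) R_{cd}ᵉ_a σ_{be} − (1/3) R_{bc}ᵉ_a σ_{de}
  + (1/3) R_{bd}ᵉ_a σ_{ce}` for an algebraic curvature operator `R` and a symmetric
bilinear form `σ`. -/
def RtriAlg {V : Type*} [AddCommGroup V] [Module ℝ V]
    (R : V →ₗ[ℝ] V →ₗ[ℝ] V →ₗ[ℝ] V) (σ : V →ₗ[ℝ] V →ₗ[ℝ] ℝ)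
    (a b c d : V) : ℝ :=
  (2/3 : ℝ) * σ b (R c d a) - (1/3 : ℝ) * σ d (R b c a) + (1/3 : ℝ) * σ c (R b d a)

/-- **Properties of the lift `R ◁ σ`:**
(i) `2(R◁σ)_{b(cd)a} = R_{ca}ᶠ_b σ_{df} + R_{da}ᶠ_b σ_{cf}`;
(ii) `(R◁σ)_{b(cd)a} − (R◁σ)_{a(cd)b} = −R_{ab}ᵉ_{(c} σ_{d)e}`. -/
theorem Rtri_properties (V : Type*) [AddCommGroup V] [Module ℝ V]
    (R : V →ₗ[ℝ] V →ₗ[ℝ] V →ₗ[ℝ] V)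
    (hRskew : ∀ a b c, R a b c = - R b a c)
    (hRbianchi : ∀ a b c, R a b c + R b c a + R c a b = 0)
    (σ : V →ₗ[ℝ] V →ₗ[ℝ] ℝ)
    (hσsym : ∀ a b, σ a b = σ b a) :
    (∀ a b c d, RtriAlg R σ b c d a + RtriAlg R σ b d c a
        = σ c (R d a b) + σ d (R c a b)) ∧
    (∀ a b c d,
        (1/2 : ℝ) * (RtriAlg R σ b c d a + RtriAlg R σ b d c a)
          - (1/2 : ℝ) * (RtriAlg R σ a c d b + RtriAlg R σ a d c b)
        = - (1/2 : ℝ) * (σ d (R a b c) + σ c (R a b d))) := by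
  have symm_part : ∀ a b c d, RtriAlg R σ b c d a + RtriAlg R σ b d c a
      = σ c (R d a b) + σ d (R c a b) := by
    intro a b c d
    simp only [RtriAlg, hRskew d c b, map_neg]
    ring
  have bianchi_apply : ∀ a b c x, σ x (R c a b) - σ x (R c b a) = - σ x (R a b c) := by
    intro a b c x
    have h := congrArg (σ x) (hRbianchi a b c)
    simp only [hRskew b c a, map_add, map_neg, map_zero] at h
    linarith
  refine ⟨symm_part, fun a b c d => ?_⟩
  rw [symm_part a b c d, symm_part b a c d]
  linarith [bianchi_apply a b c d, bianchi_apply a b d c]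

end
end
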